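/- arXiv:0910.2378 — 2 statements merged into one kernel-verified Lean document; each statement's English description precedes it below -/
import Mathlib

section
/- Let X be a geodesic metric space which is tree-graded with respect to a collection 𝒫 of pieces. Let n be a positive integer and let r > 0 and f(r) ≥ r be real numbers. If every piece of X has dimension ≤ n at the scale r of magnitude f(r), then X has dimension ≤ n at the scale r of magnitude 300·f(r). -/
open Set Metric

section Core

variable {X : Type*} [MetricSpace X]

/-- A geodesic segment parametrized by the interval `[a, b]`:
an isometric embedding of `[a, b]` into `X`. -/
def IsGeodesicSegment (γ : ℝ → X) (a b : ℝ) : Prop :=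
  ∀ s ∈ Set.Icc a b, ∀ t ∈ Set.Icc a b, dist (γ s) (γ t) = |s - t|

/-- A metric space is geodesic if every two points are joined by a geodesic. -/
def GeodesicSpace (X : Type*) [MetricSpace X] : Prop :=
  ∀ x y : X, ∃ γ : ℝ → X, IsGeodesicSegment γ 0 (dist x y) ∧ γ 0 = x ∧ γ (dist x y) = y

/-- A subset is geodesic if every two of its points are joined by a geodesic of `X`
contained in the subset. -/
def IsGeodesicSubset (S : Set X) : Prop :=
  ∀ x ∈ S, ∀ y ∈ S, ∃ γ : ℝ → X, IsGeodesicSegment γ 0 (dist x y) ∧ γ 0 = x ∧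
    γ (dist x y) = y ∧ ∀ t ∈ Set.Icc (0 : ℝ) (dist x y), γ t ∈ S

/-- A (complete geodesic) metric space is tree-graded with respect to a collection `PX`
of closed geodesic subsets (pieces) covering `X` if every two different pieces meet in
at most one point (T₁) and every simple loop (injective continuous image of a circle)
is contained in one piece (T₂''). -/
structure IsTreeGraded (X : Type*) [MetricSpace X] (PX : Set (Set X)) : Prop where
  nonempty : ∀ P ∈ PX, P.Nonempty
  closed : ∀ P ∈ PX, IsClosed P
  geodesicSub : ∀ P ∈ PX, IsGeodesicSubset P
  covers : ∀ x : X, ∃ P ∈ PX, x ∈ P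
  t1 : ∀ P ∈ PX, ∀ Q ∈ PX, P ≠ Q → (P ∩ Q).Subsingleton
  t2 : ∀ loop : AddCircle (1 : ℝ) → X, Continuous loop → Function.Injective loop →
    ∃ P ∈ PX, Set.range loop ⊆ P

end Core
section Chains

variable {Y : Type*}

/-- An `r`-chain from `x` to `y` inside the set `S`, with respect to the distance
function `d`: a finite sequence `x = c 0, c 1, …, c m = y` of points of `S` with
consecutive distances `< r`. -/
def IsDChain (d : Y → Y → ℝ) (r : ℝ) (S : Set Y) (x y : Y) : Prop :=
  ∃ (m : ℕ) (c : ℕ → Y), c 0 = x ∧ c m = y ∧ (∀ i ≤ m, c i ∈ S) ∧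
    ∀ i < m, d (c i) (c (i + 1)) < r

/-- A set is `r`-scale connected if every two of its points are joined by an
`r`-chain contained in it. -/
def DScaleConnected (d : Y → Y → ℝ) (r : ℝ) (S : Set Y) : Prop :=
  ∀ x ∈ S, ∀ y ∈ S, IsDChain d r S x y

/-- `C` is an `r`-scale connected component of `U`: a maximal `r`-scale connected
subset of `U`. -/
def IsDComponent (d : Y → Y → ℝ) (r : ℝ) (U C : Set Y) : Prop :=
  C ⊆ U ∧ DScaleConnected d r C ∧
    ∀ C', C ⊆ C' → C' ⊆ U → DScaleConnected d r C' → C = C'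

/-- A set is `M`-bounded: its diameter is at most `M`. -/
def DBounded (d : Y → Y → ℝ) (M : ℝ) (S : Set Y) : Prop :=
  ∀ x ∈ S, ∀ y ∈ S, d x y ≤ M

/-- A space has dimension `≤ n` at scale `s` of magnitude `M` if there is a cover by
`n + 1` sets such that every `s`-scale connected component of each of them is
`M`-bounded. -/
def DimLeAtScale (d : Y → Y → ℝ) (n : ℕ) (s M : ℝ) : Prop :=
  ∃ U : Fin (n + 1) → Set Y, (∀ y, ∃ i, y ∈ U i) ∧
    ∀ i C, IsDComponent d s (U i) C → DBounded d M C

end Chains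
/-- A subset of a metric space, with its induced metric, has dimension `≤ n` at scale
`s` of magnitude `M`. -/
def SetDimLeAtScale {X : Type*} [MetricSpace X] (S : Set X) (n : ℕ) (s M : ℝ) : Prop :=
  DimLeAtScale (fun a b : S => dist (a : X) (b : X)) n s M

section Arcs

variable {X : Type*} [TopologicalSpace X]

/-- `S` is the image of an injective path from `x` to `y`. -/
def IsArc (S : Set X) (x y : X) : Prop :=
  ∃ γ : Path x y, Function.Injective γ ∧ Set.range γ = S

theorem IsArc.symm {S : Set X} {x y : X} (h : IsArc S x y) : IsArc S y x := by
  obtain ⟨γ, hγ, rfl⟩ := h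
  refine ⟨γ.symm, ?_, γ.symm_range⟩
  exact hγ.comp unitInterval.symm_bijective.injective

theorem IsArc.trans {S T : Set X} {x y z : X} (hS : IsArc S x y) (hT : IsArc T y z)
    (hST : ∀ p ∈ S, p ∈ T → p = y) : IsArc (S ∪ T) x z := by
  obtain ⟨γ, hγ, rfl⟩ := hS
  obtain ⟨δ, hδ, rfl⟩ := hT
  refine ⟨γ.trans δ, ?_, Path.trans_range γ δ⟩
  have key : ∀ s t : unitInterval, γ s = δ t → s = 1 ∧ t = 0 := by
    intro s t h
    have h1 : γ s = y := hST _ ⟨s, rfl⟩ ⟨t, h.symm⟩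
    exact ⟨hγ (h1.trans γ.target.symm), hδ ((h.symm.trans h1).trans δ.source.symm)⟩
  intro s t hst
  rw [Path.trans_apply, Path.trans_apply] at hst
  split_ifs at hst with h1 h2 h2
  · have := congrArg Subtype.val (hγ hst)
    apply Subtype.ext
    simp only at this
    linarith
  · have := (congrArg Subtype.val (key _ _ hst).2 : (_ : ℝ) = 0)
    simp only [Set.Icc.coe_zero] at this
    exact absurd (by linarith : (t : ℝ) ≤ 1 / 2) h2
  · have := (congrArg Subtype.val (key _ _ hst.symm).2 : (_ : ℝ) = 0)
    simp only [Set.Icc.coe_zero] at this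
    exact absurd (by linarith : (s : ℝ) ≤ 1 / 2) h1
  · have := congrArg Subtype.val (hδ hst)
    apply Subtype.ext
    simp only at this
    linarith

theorem isArc_image_Icc {f : ℝ → X} {a b : ℝ} (hab : a < b) (hc : ContinuousOn f (Icc a b))
    (hi : InjOn f (Icc a b)) : IsArc (f '' Icc a b) (f a) (f b) := by
  have hm : ∀ u ∈ Icc (0 : ℝ) 1, a + (b - a) * u ∈ Icc a b := by
    intro u hu
    constructor
    · nlinarith [hu.1]
    · nlinarith [hu.2]
  have hg : ContinuousOn (fun u : ℝ => f (a + (b - a) * u)) unitInterval :=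
    hc.comp (by fun_prop) hm
  refine ⟨Path.ofLine hg (by simp) (by simp), ?_, ?_⟩
  · intro s t hst
    have h1 := hi (hm s s.2) (hm t t.2) hst
    apply Subtype.ext
    have h2 : (b - a) * (s : ℝ) = (b - a) * t := by linarith
    exact mul_left_cancel₀ (by linarith : b - a ≠ 0) h2
  · ext p
    constructor
    · rintro ⟨u, rfl⟩
      exact ⟨_, hm u u.2, rfl⟩
    · rintro ⟨t, ht, rfl⟩
      have hba : 0 < b - a := by linarith
      refine ⟨⟨(t - a) / (b - a), ?_, ?_⟩, ?_⟩
      · exact div_nonneg (by linarith [ht.1]) hba.le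
      · rw [div_le_one hba]; linarith [ht.2]
      · change f (a + (b - a) * ((t - a) / (b - a))) = f t
        congr 1
        field_simp
        ring

/-- Two arcs with common endpoints and otherwise disjoint form a simple loop. -/
theorem IsArc.exists_loop {S T : Set X} {x y : X} (hS : IsArc S x y) (hT : IsArc T x y)
    (hST : ∀ p ∈ S, p ∈ T → p = x ∨ p = y) :
    ∃ loop : AddCircle (1 : ℝ) → X, Continuous loop ∧ Function.Injective loop ∧
      S ∪ T ⊆ Set.range loop := by
  obtain ⟨γ, hγ, rfl⟩ := hS
  obtain ⟨δ, hδ, rfl⟩ := hT.symm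
  have key : ∀ s t : unitInterval, γ s = δ t → (s = 1 ∧ t = 0) ∨ (s = 0 ∧ t = 1) := by
    intro s t h
    rcases hST _ ⟨s, rfl⟩ ⟨t, h.symm⟩ with h1 | h1
    · exact Or.inr ⟨hγ (h1.trans γ.source.symm), hδ ((h.symm.trans h1).trans δ.target.symm)⟩
    · exact Or.inl ⟨hγ (h1.trans γ.target.symm), hδ ((h.symm.trans h1).trans δ.source.symm)⟩
  set p := γ.trans δ with hp
  have hinj : ∀ s t : unitInterval, (s : ℝ) < 1 → (t : ℝ) < 1 → p s = p t → (s : ℝ) = t := by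
    intro s t hs ht hst
    rw [hp, Path.trans_apply, Path.trans_apply] at hst
    split_ifs at hst with h1 h2 h2
    · have := congrArg Subtype.val (hγ hst)
      simp only at this
      linarith
    · rcases key _ _ hst with h | h
      · have := (congrArg Subtype.val h.2 : (_ : ℝ) = 0)
        simp only [Set.Icc.coe_zero] at this
        exact absurd (by linarith : (t : ℝ) ≤ 1 / 2) h2
      · have := (congrArg Subtype.val h.2 : (_ : ℝ) = 1)
        simp only [Set.Icc.coe_one] at this
        linarith
    · rcases key _ _ hst.symm with h | h
      · have := (congrArg Subtype.val h.2 : (_ : ℝ) = 0)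
        simp only [Set.Icc.coe_zero] at this
        exact absurd (by linarith : (s : ℝ) ≤ 1 / 2) h1
      · have := (congrArg Subtype.val h.2 : (_ : ℝ) = 1)
        simp only [Set.Icc.coe_one] at this
        linarith
    · have := congrArg Subtype.val (hδ hst)
      simp only at this
      linarith
  have hval : ∀ t ∈ Ico (0 : ℝ) 1,
      AddCircle.liftIco (1 : ℝ) 0 p.extend (t : AddCircle (1 : ℝ)) = p.extend t :=
    fun t ht => AddCircle.liftIco_zero_coe_apply ht
  have hrep : ∀ u : AddCircle (1 : ℝ), ∃ t ∈ Ico (0 : ℝ) 1, (t : AddCircle (1 : ℝ)) = u := by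
    intro u
    have : u ∈ ((↑) : ℝ → AddCircle (1 : ℝ)) '' Ico 0 (0 + 1) := by
      rw [AddCircle.coe_image_Ico_eq]; trivial
    simpa using this
  refine ⟨AddCircle.liftIco (1 : ℝ) 0 p.extend, ?_, ?_, ?_⟩
  · exact AddCircle.liftIco_zero_continuous (by simp) p.extend.continuous.continuousOn
  · intro u v huv
    obtain ⟨s, hs, rfl⟩ := hrep u
    obtain ⟨t, ht, rfl⟩ := hrep v
    rw [hval s hs, hval t ht, Path.extend_apply _ ⟨hs.1, hs.2.le⟩,
      Path.extend_apply _ ⟨ht.1, ht.2.le⟩] at huv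
    rw [show s = t from hinj _ _ hs.2 ht.2 huv]
  · rw [← Path.trans_range]
    rintro _ ⟨t, rfl⟩
    rcases lt_or_eq_of_le t.2.2 with h | h
    · refine ⟨((t : ℝ) : AddCircle (1 : ℝ)), ?_⟩
      rw [hval t ⟨t.2.1, h⟩, Path.extend_apply _ t.2]
    · refine ⟨((0 : ℝ) : AddCircle (1 : ℝ)), ?_⟩
      rw [hval 0 ⟨le_rfl, one_pos⟩, show t = 1 from Subtype.ext h]
      simp

theorem exists_first_mem {f : ℝ → X} {a b : ℝ} (hab : a ≤ b) (hc : ContinuousOn f (Icc a b))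
    {K : Set X} (hK : IsClosed K) (hb : f b ∈ K) :
    ∃ t ∈ Icc a b, f t ∈ K ∧ ∀ s ∈ Ico a t, f s ∉ K := by
  have hcl : IsClosed (Icc a b ∩ f ⁻¹' K) := hc.preimage_isClosed_of_isClosed isClosed_Icc hK
  obtain ⟨t, ht⟩ := (isCompact_Icc.of_isClosed_subset hcl inter_subset_left).exists_isLeast
    ⟨b, right_mem_Icc.2 hab, hb⟩
  refine ⟨t, ht.1.1, ht.1.2, fun s hs hsK => ?_⟩
  exact absurd (ht.2 ⟨⟨hs.1, hs.2.le.trans ht.1.1.2⟩, hsK⟩) (not_le.2 hs.2)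

theorem exists_last_mem {f : ℝ → X} {a b : ℝ} (hab : a ≤ b) (hc : ContinuousOn f (Icc a b))
    {K : Set X} (hK : IsClosed K) (ha : f a ∈ K) :
    ∃ t ∈ Icc a b, f t ∈ K ∧ ∀ s ∈ Ioc t b, f s ∉ K := by
  have hcl : IsClosed (Icc a b ∩ f ⁻¹' K) := hc.preimage_isClosed_of_isClosed isClosed_Icc hK
  obtain ⟨t, ht⟩ := (isCompact_Icc.of_isClosed_subset hcl inter_subset_left).exists_isGreatest
    ⟨a, left_mem_Icc.2 hab, ha⟩
  refine ⟨t, ht.1.1, ht.1.2, fun s hs hsK => ?_⟩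
  exact absurd (ht.2 ⟨⟨ht.1.1.1.trans hs.1.le, hs.2⟩, hsK⟩) (not_le.2 hs.1)

end Arcs

section Geodesics

variable {X : Type*} [MetricSpace X]

/-- `γ` is a geodesic from `x` to `y`, parametrized by `[0, dist x y]`. -/
def IsGeodesicFrom (γ : ℝ → X) (x y : X) : Prop :=
  IsGeodesicSegment γ 0 (dist x y) ∧ γ 0 = x ∧ γ (dist x y) = y

namespace IsGeodesicFrom

variable {γ : ℝ → X} {x y : X}

theorem continuousOn (h : IsGeodesicFrom γ x y) : ContinuousOn γ (Icc 0 (dist x y)) := by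
  have : LipschitzOnWith 1 γ (Icc 0 (dist x y)) :=
    LipschitzOnWith.of_dist_le_mul fun s hs t ht => by
      rw [h.1 s hs t ht, NNReal.coe_one, one_mul, Real.dist_eq]
  exact this.continuousOn

theorem dist_left (h : IsGeodesicFrom γ x y) {t : ℝ} (ht : t ∈ Icc 0 (dist x y)) :
    dist x (γ t) = t := by
  have h1 := h.1 0 (left_mem_Icc.2 dist_nonneg) t ht
  rw [h.2.1, zero_sub, abs_neg, abs_of_nonneg ht.1] at h1
  exact h1

theorem dist_right (h : IsGeodesicFrom γ x y) {t : ℝ} (ht : t ∈ Icc 0 (dist x y)) :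
    dist (γ t) y = dist x y - t := by
  have h1 := h.1 t ht _ (right_mem_Icc.2 dist_nonneg)
  rw [h.2.2, abs_sub_comm, abs_of_nonneg (sub_nonneg.2 ht.2)] at h1
  exact h1

theorem injOn (h : IsGeodesicFrom γ x y) : InjOn γ (Icc 0 (dist x y)) := by
  intro s hs t ht hst
  rw [← h.dist_left hs, hst, h.dist_left ht]

theorem isArc (h : IsGeodesicFrom γ x y) {s t : ℝ} (hs : 0 ≤ s) (hst : s < t)
    (ht : t ≤ dist x y) : IsArc (γ '' Icc s t) (γ s) (γ t) :=
  have hsub : Icc s t ⊆ Icc 0 (dist x y) := Icc_subset_Icc hs ht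
  isArc_image_Icc hst (h.continuousOn.mono hsub) (h.injOn.mono hsub)

theorem isClosed_image (h : IsGeodesicFrom γ x y) {s t : ℝ} (hs : 0 ≤ s) (ht : t ≤ dist x y) :
    IsClosed (γ '' Icc s t) :=
  (isCompact_Icc.image_of_continuousOn
    (h.continuousOn.mono (Icc_subset_Icc hs ht))).isClosed

theorem param_eq {δ : ℝ → X} {w : X} (h : IsGeodesicFrom γ x y) (h' : IsGeodesicFrom δ x w)
    {s t : ℝ} (hs : s ∈ Icc 0 (dist x y)) (ht : t ∈ Icc 0 (dist x w)) (hst : γ s = δ t) :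
    s = t := by
  rw [← h.dist_left hs, hst, h'.dist_left ht]

end IsGeodesicFrom

/-- A geodesic through a point realizing equality in the triangle inequality. -/
theorem GeodesicSpace.exists_through (hgeo : GeodesicSpace X) {x u y : X}
    (h : dist x u + dist u y = dist x y) :
    ∃ γ, IsGeodesicFrom γ x y ∧ γ (dist x u) = u := by
  obtain ⟨α, hα⟩ : ∃ α, IsGeodesicFrom α x u := hgeo x u
  obtain ⟨β, hβ⟩ : ∃ β, IsGeodesicFrom β u y := hgeo u y
  have hnn : 0 ≤ dist u y := dist_nonneg
  have hnn' : 0 ≤ dist x u := dist_nonneg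
  have key : ∀ s t : ℝ, s ∈ Icc 0 (dist x u) → t ∈ Icc 0 (dist u y) →
      dist (α s) (β t) = dist x u + t - s := by
    intro s t hs ht
    apply le_antisymm
    · have := dist_triangle (α s) u (β t)
      rw [hα.dist_right hs, hβ.dist_left ht] at this
      linarith
    · have := dist_triangle4 x (α s) (β t) y
      rw [hα.dist_left hs, hβ.dist_right ht] at this
      linarith
  refine ⟨fun t => if t ≤ dist x u then α t else β (t - dist x u), ⟨?_, ?_, ?_⟩, ?_⟩
  · intro s hs t ht
    simp only
    split_ifs with h1 h2 h2
    · exact hα.1 s ⟨hs.1, h1⟩ t ⟨ht.1, h2⟩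
    · rw [key s _ ⟨hs.1, h1⟩ ⟨by linarith, by linarith [ht.2]⟩, abs_sub_comm, abs_of_nonneg]
      · ring
      · linarith
    · rw [dist_comm, key t _ ⟨ht.1, h2⟩ ⟨by linarith, by linarith [hs.2]⟩, abs_of_nonneg]
      · ring
      · linarith
    · rw [hβ.1 _ ⟨by linarith, by linarith [hs.2]⟩ _ ⟨by linarith, by linarith [ht.2]⟩]
      congr 1
      ring
  · simp only
    rw [if_pos hnn', hα.2.1]
  · simp only
    split_ifs with h1
    · have h2 : dist u y = 0 := by linarith
      rw [← h, h2, add_zero, hα.2.2]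
      exact dist_eq_zero.1 h2
    · rw [← h, add_sub_cancel_left, hβ.2.2]
  · simp only [le_refl, if_true]
    exact hα.2.2

end Geodesics

section TreeGraded

variable {X : Type*} [MetricSpace X] {PX : Set (Set X)}

namespace IsTreeGraded

theorem exists_piece_of_arcs (hTG : IsTreeGraded X PX) {S T : Set X} {x y : X}
    (hS : IsArc S x y) (hT : IsArc T x y) (hST : ∀ p ∈ S, p ∈ T → p = x ∨ p = y) :
    ∃ P ∈ PX, S ⊆ P ∧ T ⊆ P := by
  obtain ⟨loop, hc, hi, hsub⟩ := hS.exists_loop hT hST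
  obtain ⟨P, hP, hP'⟩ := hTG.t2 loop hc hi
  exact ⟨P, hP, subset_union_left.trans (hsub.trans hP'),
    subset_union_right.trans (hsub.trans hP')⟩

/-- Two geodesics which diverge and are joined again by a third one start,
from the point of divergence on, in a common piece. -/
theorem exists_piece_of_triangle (hTG : IsTreeGraded X PX) {z u v : X} {α β σ : ℝ → X}
    (hα : IsGeodesicFrom α z u) (hβ : IsGeodesicFrom β z v) (hσ : IsGeodesicFrom σ u v)
    {s₀ l : ℝ} (h0 : 0 ≤ s₀) (hl : s₀ < l) (hu : l ≤ dist z u) (hv : l ≤ dist z v)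
    (heq : α s₀ = β s₀) (hne : ∀ s ∈ Ioo s₀ l, α s ≠ β s)
    (hασ : ∀ s ∈ Ico s₀ l, α s ∉ σ '' Icc 0 (dist u v))
    (hβσ : ∀ s ∈ Ico s₀ l, β s ∉ σ '' Icc 0 (dist u v)) :
    ∃ P ∈ PX, ∃ t₁ ∈ Icc l (dist z u), ∃ t₂ ∈ Icc l (dist z v),
      α '' Icc s₀ t₁ ⊆ P ∧ β '' Icc s₀ t₂ ⊆ P ∧
      (α t₁ = β t₂ ∨
        (α t₁ ∈ σ '' Icc 0 (dist u v) ∧ β t₂ ∈ σ '' Icc 0 (dist u v))) := by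
  have hl0 : 0 ≤ l := h0.trans hl.le
  have hσcl : IsClosed (σ '' Icc 0 (dist u v)) := hσ.isClosed_image le_rfl le_rfl
  have hβcl : IsClosed (β '' Icc s₀ (dist z v)) := hβ.isClosed_image h0 le_rfl
  obtain ⟨t₁, ht₁, hmem, hfirst⟩ := exists_first_mem (f := α) hu
    (hα.continuousOn.mono (Icc_subset_Icc hl0 le_rfl)) (hσcl.union hβcl)
    (Or.inl ⟨0, left_mem_Icc.2 dist_nonneg, hσ.2.1.trans hα.2.2.symm⟩)
  have hαt : ∀ {s}, s ∈ Icc s₀ t₁ → s ∈ Icc 0 (dist z u) := fun hs =>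
    ⟨h0.trans hs.1, hs.2.trans ht₁.2⟩
  have hst₁ : s₀ < t₁ := hl.trans_le ht₁.1
  have hαβ : ∀ s ∈ Ioo s₀ t₁, ∀ s' ∈ Icc s₀ (dist z v), α s ≠ β s' := by
    intro s hs s' hs' he
    have hss : s = s' := hα.param_eq hβ (hαt ⟨hs.1.le, hs.2.le⟩) ⟨h0.trans hs'.1, hs'.2⟩ he
    subst hss
    rcases lt_or_ge s l with h | h
    · exact hne s ⟨hs.1, h⟩ he
    · exact hfirst s ⟨h, hs.2⟩ (Or.inr ⟨s, hs', he.symm⟩)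
  by_cases hcase : α t₁ ∈ β '' Icc s₀ (dist z v)
  · obtain ⟨t₂, ht₂, he⟩ := hcase
    have h12 : t₁ = t₂ := hα.param_eq hβ (hαt (right_mem_Icc.2 hst₁.le))
      ⟨h0.trans ht₂.1, ht₂.2⟩ he.symm
    subst h12
    have hS := hα.isArc h0 hst₁ ht₁.2
    have hT := hβ.isArc h0 hst₁ ht₂.2
    rw [← heq, he] at hT
    obtain ⟨P, hP, hSP, hTP⟩ := hTG.exists_piece_of_arcs hS hT (by
      rintro _ ⟨s, hs, rfl⟩ ⟨s', hs', he'⟩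
      rcases hs.1.eq_or_lt with h | h
      · left; rw [h]
      rcases hs.2.eq_or_lt with h2 | h2
      · right; rw [h2]
      exact absurd he'.symm (hαβ s ⟨h, h2⟩ s' ⟨hs'.1, hs'.2.trans ht₂.2⟩))
    exact ⟨P, hP, t₁, ht₁, t₁, ⟨ht₁.1, ht₂.2⟩, hSP, hTP, Or.inl he.symm⟩
  · obtain ⟨s₁, hs₁, he₁⟩ := hmem.resolve_right hcase
    obtain ⟨s₂, hs₂, hmem₂, hfirst₂⟩ := exists_first_mem (f := σ) hs₁.2
      (hσ.continuousOn.mono (Icc_subset_Icc hs₁.1 le_rfl)) hβcl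
      ⟨dist z v, ⟨hl.le.trans hv, le_rfl⟩, hβ.2.2.trans hσ.2.2.symm⟩
    obtain ⟨t₂, ht₂, he₂⟩ := hmem₂
    have hs₂0 : 0 ≤ s₂ := hs₁.1.trans hs₂.1
    have hσ₂ : σ s₂ ∈ σ '' Icc 0 (dist u v) := ⟨s₂, ⟨hs₂0, hs₂.2⟩, rfl⟩
    have hlt₂ : l ≤ t₂ := by
      by_contra hlt
      exact hβσ t₂ ⟨ht₂.1, not_le.1 hlt⟩ (he₂ ▸ hσ₂)
    have hs₁₂ : s₁ < s₂ := by
      refine lt_of_le_of_ne hs₂.1 fun h => hcase ⟨t₂, ht₂, ?_⟩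
      rw [he₂, ← h, he₁]
    have hS₁ := hα.isArc h0 hst₁ ht₁.2
    have hS₂ := hσ.isArc hs₁.1 hs₁₂ hs₂.2
    rw [he₁, ← he₂] at hS₂
    have hS := hS₁.trans hS₂ (by
      rintro _ ⟨s, hs, rfl⟩ ⟨s', hs', he'⟩
      rcases hs.2.eq_or_lt with h2 | h2
      · rw [h2]
      have hin : α s ∈ σ '' Icc 0 (dist u v) :=
        ⟨s', ⟨hs₁.1.trans hs'.1, hs'.2.trans hs₂.2⟩, he'⟩
      rcases lt_or_ge s l with h | h
      · exact absurd hin (hασ s ⟨hs.1, h⟩)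
      · exact absurd (Or.inl hin) (hfirst s ⟨h, h2⟩))
    have hT := hβ.isArc h0 (hl.trans_le hlt₂) ht₂.2
    rw [← heq] at hT
    obtain ⟨P, hP, hSP, hTP⟩ := hTG.exists_piece_of_arcs hS hT (by
      rintro p (⟨s, hs, rfl⟩ | ⟨s, hs, rfl⟩) ⟨s', hs', he'⟩
      · have hs'' : s' ∈ Icc s₀ (dist z v) := ⟨hs'.1, hs'.2.trans ht₂.2⟩
        rcases hs.1.eq_or_lt with h | h
        · left; rw [h]
        rcases hs.2.eq_or_lt with h2 | h2
        · exact absurd ⟨s', hs'', h2 ▸ he'⟩ hcase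
        exact absurd he'.symm (hαβ s ⟨h, h2⟩ s' hs'')
      · right
        rcases hs.2.eq_or_lt with h2 | h2
        · rw [h2, he₂]
        · exact absurd ⟨s', ⟨hs'.1, hs'.2.trans ht₂.2⟩, he'⟩ (hfirst₂ s ⟨hs.1, h2⟩))
    exact ⟨P, hP, t₁, ht₁, t₂, ⟨hlt₂, ht₂.2⟩, subset_union_left.trans hSP, hTP,
      Or.inr ⟨⟨s₁, hs₁, he₁⟩, he₂ ▸ hσ₂⟩⟩

/-- The last time up to `l` at which two geodesics with the same origin agree. -/
theorem _root_.IsGeodesicFrom.exists_last_eq {α β : ℝ → X} {z u v : X}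
    (hα : IsGeodesicFrom α z u) (hβ : IsGeodesicFrom β z v) {l : ℝ} (hl : 0 ≤ l)
    (hu : l ≤ dist z u) (hv : l ≤ dist z v) :
    ∃ s₀ ∈ Icc 0 l, α s₀ = β s₀ ∧ ∀ s ∈ Ioc s₀ l, α s ≠ β s := by
  have hc : ContinuousOn (fun s => dist (α s) (β s)) (Icc 0 l) :=
    continuous_dist.comp_continuousOn
      ((hα.continuousOn.mono (Icc_subset_Icc le_rfl hu)).prodMk
        (hβ.continuousOn.mono (Icc_subset_Icc le_rfl hv)))
  obtain ⟨s₀, hs₀, h, h'⟩ := exists_last_mem hl hc (isClosed_singleton (x := (0 : ℝ)))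
    (by simp [hα.2.1, hβ.2.1])
  exact ⟨s₀, hs₀, dist_eq_zero.1 h, fun s hs he => h' s hs (dist_eq_zero.2 he)⟩

theorem exists_proj (hTG : IsTreeGraded X PX) (hgeo : GeodesicSpace X) {P : Set X} (hP : P ∈ PX)
    (z : X) : ∃ p ∈ P, ∀ q ∈ P, dist z q = dist z p + dist p q := by
  have hfirst : ∀ q ∈ P, ∃ α, IsGeodesicFrom α z q ∧ ∃ t ∈ Icc 0 (dist z q), α t ∈ P ∧
      ∀ s ∈ Ico 0 t, α s ∉ P := by
    intro q hq
    obtain ⟨α, hα⟩ : ∃ α, IsGeodesicFrom α z q := hgeo z q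
    exact ⟨α, hα, exists_first_mem dist_nonneg hα.continuousOn (hTG.closed P hP)
      (by rw [hα.2.2]; exact hq)⟩
  have hrestrict : ∀ {α : ℝ → X} {q : X} {t : ℝ}, IsGeodesicFrom α z q →
      t ∈ Icc 0 (dist z q) → IsGeodesicFrom α z (α t) := by
    intro α q t hα ht
    have hd := hα.dist_left ht
    refine ⟨?_, hα.2.1, by rw [hd]⟩
    rw [hd]
    intro a ha b hb
    exact hα.1 a ⟨ha.1, ha.2.trans ht.2⟩ b ⟨hb.1, hb.2.trans ht.2⟩
  obtain ⟨q₀, hq₀⟩ := hTG.nonempty P hP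
  obtain ⟨α, hα, t, ht, htP, htf⟩ := hfirst q₀ hq₀
  refine ⟨α t, htP, fun q hq => ?_⟩
  obtain ⟨β, hβ, t', ht', htP', htf'⟩ := hfirst q hq
  suffices h : α t = β t' by
    rw [h, hβ.dist_left ht', hβ.dist_right ht']; ring
  by_contra hne
  obtain ⟨σ, hσ, hσ0, hσ1, hσP⟩ := hTG.geodesicSub P hP _ htP _ htP'
  have hα' := hrestrict hα ht
  have hβ' := hrestrict hβ ht'
  have hd := hα.dist_left ht
  have hd' := hβ.dist_left ht'
  have hlt : min t t' ≤ dist z (α t) := (min_le_left _ _).trans hd.ge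
  have hlt' : min t t' ≤ dist z (β t') := (min_le_right _ _).trans hd'.ge
  obtain ⟨s₀, hs₀, heq, hlast⟩ := hα'.exists_last_eq hβ' (l := min t t') (le_min ht.1 ht'.1)
    hlt hlt'
  have hs₀lt : s₀ < min t t' := by
    refine lt_of_le_of_ne hs₀.2 fun h => hne ?_
    rcases le_total t t' with htt | htt
    · rw [min_eq_left htt] at h
      have : t' ≤ t := by
        by_contra hlt
        exact htf' t ⟨ht.1, not_le.1 hlt⟩ (by rw [← h, ← heq, h]; exact htP)
      rw [le_antisymm this htt, ← h, heq]
    · rw [min_eq_right htt] at h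
      have : t ≤ t' := by
        by_contra hlt
        exact htf t' ⟨ht'.1, not_le.1 hlt⟩ (by rw [← h, heq, h]; exact htP')
      rw [le_antisymm this htt, ← h, heq]
  have hσsub : σ '' Icc 0 (dist (α t) (β t')) ⊆ P := by
    rintro _ ⟨s, hs, rfl⟩
    exact hσP s hs
  obtain ⟨Q, hQ, t₁, ht₁, t₂, ht₂, hαQ, hβQ, hor⟩ :=
    hTG.exists_piece_of_triangle hα' hβ' ⟨hσ, hσ0, hσ1⟩ hs₀.1 hs₀lt hlt
      hlt' heq (fun s hs => hlast s ⟨hs.1, hs.2.le⟩)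
      (fun s hs hm => htf s ⟨hs₀.1.trans hs.1, hs.2.trans_le (min_le_left _ _)⟩ (hσsub hm))
      (fun s hs hm => htf' s ⟨hs₀.1.trans hs.1, hs.2.trans_le (min_le_right _ _)⟩ (hσsub hm))
  rw [hd] at ht₁
  rw [hd'] at ht₂
  have hmin₁ : min t t' ≤ t₁ := ht₁.1
  rcases hor with he | ⟨hσ₁, hσ₂⟩
  · have h12 : t₁ = t₂ := hα.param_eq hβ ⟨(hs₀.1.trans hs₀.2).trans ht₁.1, ht₁.2.trans ht.2⟩
      ⟨(hs₀.1.trans hs₀.2).trans ht₂.1, ht₂.2.trans ht'.2⟩ he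
    subst h12
    exact hlast t₁ ⟨hs₀lt.trans_le ht₁.1, le_min ht₁.2 ht₂.2⟩ he
  · have h1 : t₁ = t := by
      refine le_antisymm ht₁.2 (not_lt.1 fun h => ?_)
      exact htf t₁ ⟨(hs₀.1.trans hs₀.2).trans ht₁.1, h⟩ (hσsub hσ₁)
    have h2 : t₂ = t' := by
      refine le_antisymm ht₂.2 (not_lt.1 fun h => ?_)
      exact htf' t₂ ⟨(hs₀.1.trans hs₀.2).trans ht₂.1, h⟩ (hσsub hσ₂)
    subst h1 h2
    have hQP : Q = P := by
      by_contra hQP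
      exact hne (hTG.t1 Q hQ P hP hQP
        ⟨hαQ ⟨t₁, ⟨(hs₀.2.trans ht₁.1), le_rfl⟩, rfl⟩, htP⟩
        ⟨hβQ ⟨t₂, ⟨(hs₀.2.trans ht₂.1), le_rfl⟩, rfl⟩, htP'⟩)
    exact htf s₀ ⟨hs₀.1, hs₀lt.trans_le (min_le_left _ _)⟩
      (hQP ▸ hαQ ⟨s₀, ⟨le_rfl, hs₀.2.trans ht₁.1⟩, rfl⟩)

/-- If the projections of two points to a piece are different, every geodesic between the
points passes through both projections. -/
theorem dist_eq_of_proj_ne (hTG : IsTreeGraded X PX) (hgeo : GeodesicSpace X) {P : Set X}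
    (hP : P ∈ PX) {z z' p p' : X} (hp : p ∈ P) (hp' : p' ∈ P)
    (hz : ∀ q ∈ P, dist z q = dist z p + dist p q)
    (hz' : ∀ q ∈ P, dist z' q = dist z' p' + dist p' q) (hne : p ≠ p') :
    dist z z' = dist z p + dist p p' + dist p' z' := by
  obtain ⟨σ, hσ⟩ : ∃ σ, IsGeodesicFrom σ z' z := hgeo z' z
  by_cases hmeet : ∃ s ∈ Icc 0 (dist z' z), σ s ∈ P
  · obtain ⟨s, hs, hsP⟩ := hmeet
    have h1 := hσ.dist_left hs
    have h2 := hσ.dist_right hs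
    have h3 := hz _ hsP
    have h4 := hz' _ hsP
    have h5 := dist_triangle4 z p p' z'
    have h6 := dist_triangle_right p p' (σ s)
    rw [dist_comm z' p'] at h4
    rw [dist_comm (σ s)] at h2
    rw [dist_comm z' z] at h2
    linarith
  exfalso
  push Not at hmeet
  obtain ⟨α, hα⟩ : ∃ α, IsGeodesicFrom α p' z' := hgeo p' z'
  have hthrough : dist p' p + dist p z = dist p' z := by
    have := hz p' hp'
    rw [dist_comm z p', dist_comm z p, dist_comm p p'] at this
    linarith
  obtain ⟨β, hβ, hβp⟩ := hgeo.exists_through hthrough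
  have hα_proj : ∀ s ∈ Icc 0 (dist p' z'), ∀ q ∈ P,
      dist (α s) q = dist (α s) p' + dist p' q := by
    intro s hs q hq
    have h1 := hα.dist_left hs
    have h2 := hα.dist_right hs
    have h3 := hz' q hq
    have h4 := dist_triangle z' (α s) q
    have h5 := dist_triangle (α s) p' q
    have h6 := dist_comm z' p'
    have h7 := dist_comm z' (α s)
    have h8 := dist_comm (α s) p'
    linarith
  have hpos : 0 < dist p' p := dist_pos.2 hne.symm
  have hz'p : p' ≠ z' := by
    intro h
    exact hmeet 0 (left_mem_Icc.2 dist_nonneg) (by rw [hσ.2.1, ← h]; exact hp')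
  have hαβ : ∀ s ∈ Icc 0 (dist p' z'), s ≤ dist p' z → 0 < s → α s ≠ β s := by
    intro s hs hs' hspos he
    have h1 := hα_proj s hs p hp
    have h2 := hα.dist_left hs
    have h3 := dist_comm (α s) p'
    have hsβ : s ∈ Icc 0 (dist p' z) := ⟨hs.1, hs'⟩
    have h4 := hβ.1 s hsβ _ ⟨hpos.le, by linarith [dist_nonneg (x := p) (y := z)]⟩
    rw [hβp, ← he, h1] at h4
    rcases abs_cases (s - dist p' p) with ⟨h, _⟩ | ⟨h, _⟩ <;> linarith
  have hσcl : IsClosed (σ '' Icc 0 (dist z' z)) := hσ.isClosed_image le_rfl le_rfl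
  have hp'σ : p' ∉ σ '' Icc 0 (dist z' z) := by
    rintro ⟨s, hs, h⟩
    exact hmeet s hs (h ▸ hp')
  obtain ⟨ε, hε, hball⟩ := Metric.isOpen_iff.1 hσcl.isOpen_compl p' hp'σ
  set l := min ε (min (dist p' z') (dist p' z)) with hl
  have hzpos : 0 < dist p' z := by linarith [dist_nonneg (x := p) (y := z)]
  have hlpos : 0 < l := lt_min hε (lt_min (dist_pos.2 hz'p) hzpos)
  have hlu : l ≤ dist p' z' := (min_le_right _ _).trans (min_le_left _ _)
  have hlv : l ≤ dist p' z := (min_le_right _ _).trans (min_le_right _ _)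
  obtain ⟨Q, hQ, t₁, ht₁, t₂, ht₂, hαQ, hβQ, hor⟩ :=
    hTG.exists_piece_of_triangle hα hβ hσ le_rfl hlpos hlu hlv (hα.2.1.trans hβ.2.1.symm)
      (fun s hs => hαβ s ⟨hs.1.le, hs.2.le.trans hlu⟩ (hs.2.le.trans hlv) hs.1)
      (fun s hs => hball (by
        rw [mem_ball, dist_comm, hα.dist_left ⟨hs.1, hs.2.le.trans hlu⟩]
        exact hs.2.trans_le (min_le_left _ _)))
      (fun s hs => hball (by
        rw [mem_ball, dist_comm, hβ.dist_left ⟨hs.1, hs.2.le.trans hlv⟩]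
        exact hs.2.trans_le (min_le_left _ _)))
  have ht₁' : t₁ ∈ Icc 0 (dist p' z') := ⟨hlpos.le.trans ht₁.1, ht₁.2⟩
  have ht₂' : t₂ ∈ Icc 0 (dist p' z) := ⟨hlpos.le.trans ht₂.1, ht₂.2⟩
  rcases hor with he | ⟨_, s, hs, he⟩
  · have h12 := hα.param_eq hβ ht₁' ht₂' he
    subst h12
    exact hαβ t₁ ht₁' ht₂.2 (hlpos.trans_le ht₁.1) he
  · have hlt : dist p' p ≤ t₂ := by
      by_contra hlt
      obtain ⟨v, hv, hvq⟩ := hTG.exists_proj hgeo hP (β t₂)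
      have h1 := hβ.dist_left ht₂'
      have h2 := hβ.1 t₂ ht₂' _ ⟨hpos.le, by linarith [dist_nonneg (x := p) (y := z)]⟩
      rw [hβp, abs_sub_comm, abs_of_pos (by linarith)] at h2
      have h3 := hvq p hp
      have h4 := hvq p' hp'
      have h5 := dist_triangle_left p' p v
      have h6 : dist (β t₂) v = 0 := by
        rw [dist_comm p' (β t₂)] at h1
        linarith [dist_nonneg (x := β t₂) (y := v)]
      exact hmeet s hs (by rw [he, dist_eq_zero.1 h6]; exact hv)
    have hQP : Q = P := by
      by_contra hQP
      refine hne (hTG.t1 Q hQ P hP hQP ⟨?_, hp⟩ ⟨?_, hp'⟩)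
      · rw [← hβp]
        exact hβQ ⟨_, ⟨hpos.le, hlt⟩, rfl⟩
      · rw [← hβ.2.1]
        exact hβQ ⟨0, ⟨le_rfl, ht₂'.1⟩, rfl⟩
    exact hmeet s hs (by rw [he, ← hQP]; exact hβQ ⟨t₂, ⟨ht₂'.1, le_rfl⟩, rfl⟩)

/-- If a geodesic from `z` to `z'` stays outside the ball of radius `l` about `x₀`, then geodesics
from `x₀` to `z` and `z'` pass through the sphere of radius `l` in the same point or
in the same piece. -/
theorem eq_or_exists_piece_of_level (hTG : IsTreeGraded X PX) (hgeo : GeodesicSpace X)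
    {x₀ z z' : X} {α β : ℝ → X} (hα : IsGeodesicFrom α x₀ z) (hβ : IsGeodesicFrom β x₀ z')
    {l : ℝ} (h0 : 0 ≤ l)
    (hlevel : ∀ u, dist z u + dist u z' = dist z z' → l ≤ dist x₀ u) :
    α l = β l ∨ ∃ P ∈ PX, α l ∈ P ∧ β l ∈ P := by
  obtain ⟨σ, hσ⟩ : ∃ σ, IsGeodesicFrom σ z z' := hgeo z z'
  have hu : l ≤ dist x₀ z := hlevel z (by simp)
  have hv : l ≤ dist x₀ z' := hlevel z' (by simp)
  obtain ⟨s₀, hs₀, heq, hlast⟩ := hα.exists_last_eq hβ h0 hu hv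
  rcases hs₀.2.eq_or_lt with h | h
  · left; rw [← h, heq]
  right
  have hσl : ∀ u ∈ σ '' Icc 0 (dist z z'), l ≤ dist x₀ u := by
    rintro _ ⟨s, hs, rfl⟩
    apply hlevel
    rw [hσ.dist_left hs, hσ.dist_right hs]
    ring
  obtain ⟨P, hP, t₁, ht₁, t₂, ht₂, hαP, hβP, -⟩ :=
    hTG.exists_piece_of_triangle hα hβ hσ hs₀.1 h hu hv heq
      (fun s hs => hlast s ⟨hs.1, hs.2.le⟩)
      (fun s hs hm => by
        have h1 := hσl _ hm
        rw [hα.dist_left ⟨hs₀.1.trans hs.1, hs.2.le.trans hu⟩] at h1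
        exact absurd hs.2 (not_lt.2 h1))
      (fun s hs hm => by
        have h1 := hσl _ hm
        rw [hβ.dist_left ⟨hs₀.1.trans hs.1, hs.2.le.trans hv⟩] at h1
        exact absurd hs.2 (not_lt.2 h1))
  exact ⟨P, hP, hαP ⟨l, ⟨h.le, ht₁.1⟩, rfl⟩, hβP ⟨l, ⟨h.le, ht₂.1⟩, rfl⟩⟩

end IsTreeGraded

end TreeGraded

section Projections

variable {X : Type*} [MetricSpace X] {PX : Set (Set X)} {pr : Set X → X → X}

/-- The metric properties of the family of projections to the pieces of a tree-graded space. -/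
structure IsProjectionSystem (PX : Set (Set X)) (pr : Set X → X → X) : Prop where
  mem : ∀ {P}, P ∈ PX → ∀ z, pr P z ∈ P
  dist_eq : ∀ {P}, P ∈ PX → ∀ z, ∀ q ∈ P, dist z q = dist z (pr P z) + dist (pr P z) q
  dist_eq_of_ne : ∀ {P}, P ∈ PX → ∀ {z z'}, pr P z ≠ pr P z' →
    dist z z' = dist z (pr P z) + dist (pr P z) (pr P z') + dist (pr P z') z'
  subsingleton_inter : ∀ {P Q}, P ∈ PX → Q ∈ PX → P ≠ Q → (P ∩ Q).Subsingleton

theorem IsTreeGraded.exists_projectionSystem (hTG : IsTreeGraded X PX) (hgeo : GeodesicSpace X) :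
    ∃ pr, IsProjectionSystem PX pr := by
  classical
  choose! pr hmem hdist using fun P (hP : P ∈ PX) => hTG.exists_proj hgeo hP
  exact ⟨pr, fun hP z => hmem _ hP z, fun hP z => hdist _ hP z, fun hP z z' hne =>
    hTG.dist_eq_of_proj_ne hgeo hP (hmem _ hP z) (hmem _ hP z') (hdist _ hP z) (hdist _ hP z') hne,
    fun hP hQ hPQ => hTG.t1 _ hP _ hQ hPQ⟩

/-- The pieces which a point `z` sees from `x₀` through a projection interval of length at
least `R`, together with the piece `{x₀}`. -/
def anchors (PX : Set (Set X)) (pr : Set X → X → X) (x₀ : X) (R : ℝ) (z : X) : Set (Set X) :=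
  {Q | Q ∈ PX ∧ (Q = {x₀} ∨ R ≤ dist (pr Q x₀) (pr Q z))}

/-- `Q` is the anchor of `z` farthest from `x₀`. -/
def IsLastAnchor (PX : Set (Set X)) (pr : Set X → X → X) (x₀ : X) (R : ℝ) (Q : Set X) (z : X) :
    Prop :=
  Q ∈ anchors PX pr x₀ R z ∧
    ∀ Q' ∈ anchors PX pr x₀ R z, Q' ≠ Q → dist x₀ (pr Q' z) ≤ dist x₀ (pr Q x₀)

/-- The point `z'`, close to its last anchor `Q'`, is next to the point `z`, which is far from
its last anchor `Q`, and `Q` is also the last anchor of the entrance of `Q'`. -/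
structure IsAttached (PX : Set (Set X)) (pr : Set X → X → X) (x₀ : X) (r R : ℝ)
    (Q : Set X) (z : X) (Q' : Set X) (z' : X) : Prop where
  last : IsLastAnchor PX pr x₀ R Q (pr Q' x₀)
  proj_eq : pr Q (pr Q' x₀) = pr Q z
  ne : Q' ≠ {x₀}
  near : dist (pr Q' z') z' < r
  height : |dist x₀ z - (dist x₀ (pr Q' x₀) + R)| ≤ r
  far : R - r ≤ dist (pr Q z) z

namespace IsProjectionSystem

variable {P Q Q' : Set X} {x₀ z z' : X} {r R : ℝ}

theorem proj_of_mem (h : IsProjectionSystem PX pr)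
    (hP : P ∈ PX) {q : X} (hq : q ∈ P) : pr P q = q := by
  have h1 := h.dist_eq hP q q hq
  rw [dist_self] at h1
  have h2 : dist (pr P q) q = 0 := by
    linarith [dist_nonneg (x := q) (y := pr P q), dist_nonneg (x := pr P q) (y := q)]
  exact dist_eq_zero.1 h2

theorem mem_of_between (h : IsProjectionSystem PX pr)
    (hP : P ∈ PX) {p q u : X} (hp : p ∈ P) (hq : q ∈ P)
    (hu : dist p u + dist u q = dist p q) : u ∈ P := by
  have h1 := h.dist_eq hP u p hp
  have h2 := h.dist_eq hP u q hq
  have h3 := dist_triangle_left p q (pr P u)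
  rw [dist_comm u p] at h1
  have h4 : dist u (pr P u) = 0 := by linarith [dist_nonneg (x := u) (y := pr P u)]
  rw [dist_eq_zero.1 h4]
  exact h.mem hP u

/-- The projection to a piece is constant on every other piece. -/
theorem proj_eq_proj (h : IsProjectionSystem PX pr)
    (hQ : Q ∈ PX) (hQ' : Q' ∈ PX) (hne : Q ≠ Q') {a b : X} (ha : a ∈ Q')
    (hb : b ∈ Q') : pr Q a = pr Q b := by
  by_contra hab
  have h1 := h.dist_eq_of_ne hQ hab
  have hmem : pr Q a ∈ Q' := by
    apply h.mem_of_between hQ' ha hb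
    apply le_antisymm
    · have := dist_triangle (pr Q a) (pr Q b) b
      linarith
    · exact dist_triangle _ _ _
  have hmem' : pr Q b ∈ Q' := by
    apply h.mem_of_between hQ' ha hb
    apply le_antisymm
    · have := dist_triangle a (pr Q a) (pr Q b)
      linarith
    · exact dist_triangle _ _ _
  exact hab (h.subsingleton_inter hQ hQ' hne ⟨h.mem hQ a, hmem⟩ ⟨h.mem hQ b, hmem'⟩)

theorem dist_proj_mem (h : IsProjectionSystem PX pr) (hQ : Q ∈ PX) (x₀ : X) {q : X} (hq : q ∈ Q) :
    dist x₀ q = dist x₀ (pr Q x₀) + dist (pr Q x₀) q :=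
  h.dist_eq hQ x₀ q hq

/-- The projection intervals of two different pieces along a point do not overlap. -/
theorem le_or_le (h : IsProjectionSystem PX pr)
    (hQ : Q ∈ PX) (hQ' : Q' ∈ PX) (hne : Q ≠ Q') (hz : pr Q z ≠ pr Q x₀)
    (hz' : pr Q' z ≠ pr Q' x₀) :
    dist x₀ (pr Q z) ≤ dist x₀ (pr Q' x₀) ∨ dist x₀ (pr Q' z) ≤ dist x₀ (pr Q x₀) := by
  have hab := h.proj_eq_proj hQ hQ' hne (h.mem hQ' x₀) (h.mem hQ' z)
  have hx := h.dist_eq_of_ne hQ hz.symm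
  have hx' := h.dist_eq_of_ne hQ' hz'.symm
  have hy := h.dist_proj_mem hQ x₀ (h.mem hQ z)
  have hy' := h.dist_proj_mem hQ' x₀ (h.mem hQ' z)
  by_cases hay : pr Q (pr Q' x₀) = pr Q z
  · left
    have h1 : pr Q x₀ ≠ pr Q (pr Q' x₀) := by rw [hay]; exact hz.symm
    have h2 := h.dist_eq_of_ne hQ h1
    rw [hay] at h2
    linarith [dist_nonneg (x := pr Q z) (y := pr Q' x₀)]
  right
  have hby : pr Q (pr Q' z) ≠ pr Q z := by rwa [← hab]
  have h1 := h.dist_eq_of_ne hQ hby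
  by_cases hap : pr Q x₀ = pr Q (pr Q' z)
  · rw [← hap] at h1
    linarith [dist_nonneg (x := pr Q' z) (y := pr Q x₀)]
  · exfalso
    have h2 := h.dist_eq_of_ne hQ hap
    have hap' : pr Q x₀ ≠ pr Q (pr Q' x₀) := by rwa [hab]
    have h3 := h.dist_eq_of_ne hQ hap'
    have h4 := h.dist_eq_of_ne hQ hay
    rw [hab] at h3 h4
    set a := pr Q (pr Q' z)
    have h5 := dist_triangle (pr Q x₀) a (pr Q z)
    have h6 := dist_triangle (pr Q' x₀) (pr Q' z) z
    have h7 := dist_comm a (pr Q' z)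
    have h8 := dist_comm a (pr Q' x₀)
    have h9 := dist_nonneg (x := pr Q' z) (y := a)
    have h10 := dist_nonneg (x := pr Q' x₀) (y := a)
    have e1 : dist (pr Q' x₀) a = 0 := by linarith
    have e2 : dist (pr Q' z) a = 0 := by linarith
    exact hz' ((dist_eq_zero.1 e2).trans (dist_eq_zero.1 e1).symm)

/-- Lying in a common piece is transitive on the spheres about `x₀`. -/
theorem common_piece_trans (h : IsProjectionSystem PX pr)
    {l : ℝ} {a b c : X} (ha : dist x₀ a = l) (hb : dist x₀ b = l)
    (hc : dist x₀ c = l) (hab : a = b ∨ ∃ P ∈ PX, a ∈ P ∧ b ∈ P)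
    (hbc : b = c ∨ ∃ P ∈ PX, b ∈ P ∧ c ∈ P) : a = c ∨ ∃ P ∈ PX, a ∈ P ∧ c ∈ P := by
  rcases hab with rfl | ⟨P, hP, haP, hbP⟩
  · exact hbc
  rcases hbc with rfl | ⟨Q, hQ, hbQ, hcQ⟩
  · exact Or.inr ⟨P, hP, haP, hbP⟩
  by_cases hab : a = b
  · exact Or.inr ⟨Q, hQ, hab ▸ hbQ, hcQ⟩
  by_cases hbc : b = c
  · exact Or.inr ⟨P, hP, haP, hbc ▸ hbP⟩
  by_cases hPQ : P = Q
  · exact Or.inr ⟨P, hP, haP, hPQ ▸ hcQ⟩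
  exfalso
  have hne : ∀ {S : Set X} {u v : X}, S ∈ PX → u ∈ S → v ∈ S → dist x₀ u = l → dist x₀ v = l →
      u ≠ v → dist x₀ (pr S x₀) < l := by
    intro S u v hS hu hv hul hvl huv
    have h1 := h.dist_proj_mem hS x₀ hu
    have h2 := h.dist_proj_mem hS x₀ hv
    have h3 := dist_triangle_left u v (pr S x₀)
    linarith [dist_pos.2 huv]
  have hP' := hne hP haP hbP ha hb hab
  have hQ' := hne hQ hbQ hcQ hb hc hbc
  have hPb := h.proj_of_mem hP hbP
  have hQb := h.proj_of_mem hQ hbQ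
  rcases h.le_or_le (z := b) (x₀ := x₀) hP hQ hPQ (by rw [hPb]; rintro rfl; linarith)
    (by rw [hQb]; rintro rfl; linarith) with h1 | h1
  · rw [hPb] at h1; linarith
  · rw [hQb] at h1; linarith

theorem proj_singleton (h : IsProjectionSystem PX pr)
    (hx₀ : {x₀} ∈ PX) (z : X) : pr {x₀} z = x₀ := h.mem hx₀ z

theorem dist_eq_of_mem_anchors (h : IsProjectionSystem PX pr)
    (hR : 0 < R) (hQ : Q ∈ anchors PX pr x₀ R z) :
    dist x₀ z = dist x₀ (pr Q z) + dist (pr Q z) z := by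
  rcases hQ with ⟨hQ, rfl | hQR⟩
  · rw [h.proj_singleton hQ, dist_self, zero_add]
  · rw [h.dist_proj_mem hQ x₀ (h.mem hQ z)]
    exact h.dist_eq_of_ne hQ (dist_pos.1 (hR.trans_le hQR))

theorem exists_isLastAnchor (h : IsProjectionSystem PX pr) (hx₀ : {x₀} ∈ PX) (hR : 0 < R) (z : X) :
    ∃ Q, IsLastAnchor PX pr x₀ R Q z := by
  set E := (fun Q => dist x₀ (pr Q z)) '' anchors PX pr x₀ R z with hE
  have hne : E.Nonempty := ⟨_, {x₀}, ⟨hx₀, Or.inl rfl⟩, rfl⟩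
  have hbdd : BddAbove E := by
    refine ⟨dist x₀ z, ?_⟩
    rintro _ ⟨Q, hQ, rfl⟩
    have := h.dist_eq_of_mem_anchors hR hQ
    simp only
    linarith [dist_nonneg (x := pr Q z) (y := z)]
  obtain ⟨_, ⟨Q, hQ, rfl⟩, hQs⟩ := exists_lt_of_lt_csSup hne (sub_lt_self (sSup E) hR)
  refine ⟨Q, hQ, fun Q' hQ' hQQ => ?_⟩
  have hle := le_csSup hbdd ⟨Q', hQ', rfl⟩
  simp only at hle hQs
  rcases hQ'.2 with rfl | hR'
  · rw [h.proj_singleton hQ'.1, dist_self]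
    exact dist_nonneg
  have h1 := h.dist_proj_mem hQ'.1 x₀ (h.mem hQ'.1 z)
  rcases hQ.2 with rfl | hRQ
  · rw [h.proj_singleton hQ.1, dist_self] at hQs
    linarith [dist_nonneg (x := x₀) (y := pr Q' x₀)]
  rcases h.le_or_le hQ.1 hQ'.1 hQQ.symm (dist_pos.1 (hR.trans_le hRQ)).symm
    (dist_pos.1 (hR.trans_le hR')).symm with h2 | h2
  · linarith
  · exact h2

theorem isLastAnchor_unique (h : IsProjectionSystem PX pr)
    (hR : 0 < R) (hQ : IsLastAnchor PX pr x₀ R Q z)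
    (hQ' : IsLastAnchor PX pr x₀ R Q' z) : Q = Q' := by
  by_contra hne
  have h1 := hQ.2 Q' hQ'.1 (Ne.symm hne)
  have h2 := hQ'.2 Q hQ.1 hne
  have h3 := h.dist_proj_mem hQ.1.1 x₀ (h.mem hQ.1.1 z)
  have h4 := h.dist_proj_mem hQ'.1.1 x₀ (h.mem hQ'.1.1 z)
  have h5 := dist_nonneg (x := pr Q x₀) (y := pr Q z)
  have h6 := dist_nonneg (x := pr Q' x₀) (y := pr Q' z)
  rcases hQ.1.2 with e | e
  · rcases hQ'.1.2 with e' | e'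
    · exact hne (e.trans e'.symm)
    · linarith
  · linarith

/-- The last anchor of the entrance of a piece `Q'` is the anchor of `z` preceding `Q'`. -/
theorem isLastAnchor_entrance (h : IsProjectionSystem PX pr) (hx₀ : {x₀} ∈ PX) (hR : 0 < R)
    (hQ : IsLastAnchor PX pr x₀ R Q z) (hQ' : Q' ∈ PX) (hz : pr Q' z ≠ pr Q' x₀)
    (hproj : pr Q (pr Q' x₀) = pr Q z) :
    IsLastAnchor PX pr x₀ R Q (pr Q' x₀) := by
  obtain ⟨p, hp⟩ : ∃ p, p = pr Q' x₀ := ⟨_, rfl⟩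
  rw [← hp] at hz hproj ⊢
  have hQp : Q ∈ anchors PX pr x₀ R p := ⟨hQ.1.1, by rw [hproj]; exact hQ.1.2⟩
  obtain ⟨S, hS⟩ := h.exists_isLastAnchor hx₀ hR p
  suffices hSQ : S = Q by rwa [hSQ] at hS
  by_contra hSQ
  have h1 := hS.2 Q hQp (Ne.symm hSQ)
  rw [hproj] at h1
  have hQy := h.dist_proj_mem hQ.1.1 x₀ (h.mem hQ.1.1 z)
  have hSu := h.dist_proj_mem hS.1.1 x₀ (h.mem hS.1.1 p)
  have hSp := h.dist_eq_of_mem_anchors hR hS.1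
  have hnnQ := dist_nonneg (x := pr Q x₀) (y := pr Q z)
  have hSR : R ≤ dist (pr S x₀) (pr S p) := by
    rcases hS.1.2 with rfl | e
    · rw [h.proj_singleton hS.1.1, dist_self] at h1
      rcases hQ.1.2 with e | e
      · exact absurd e.symm hSQ
      · linarith [dist_nonneg (x := x₀) (y := pr Q x₀)]
    · exact e
  by_cases hu : pr S z = pr S p
  · have h2 := hQ.2 S ⟨hS.1.1, Or.inr (by rw [hu]; exact hSR)⟩ hSQ
    rw [hu] at h2
    linarith
  have h2 := h.dist_eq_of_ne hS.1.1 (Ne.symm hu)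
  have h3 := h.dist_eq_of_ne hQ' (hp ▸ hz.symm)
  have h4 := h.dist_proj_mem hQ' x₀ (h.mem hQ' z)
  rw [← hp] at h3 h4
  have h5 := dist_triangle p (pr Q' z) z
  have h6 := dist_triangle x₀ p z
  have h7 := dist_comm (pr S p) p
  have h8 := dist_comm (pr S p) (pr S x₀)
  by_cases hu0 : pr S z = pr S x₀
  · rw [hu0] at h2
    have h9 := dist_triangle x₀ (pr S x₀) z
    linarith [dist_nonneg (x := p) (y := pr S p)]
  have h9 := h.dist_eq_of_ne hS.1.1 (Ne.symm hu0)
  have h10 := dist_triangle (pr S x₀) (pr S p) (pr S z)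
  have h11 : dist p (pr S p) = 0 := by linarith [dist_nonneg (x := p) (y := pr S p)]
  have hup : pr S p = p := (dist_eq_zero.1 h11).symm
  have hSQ' : S ≠ Q' := by
    rintro rfl
    rw [hup, ← hp, dist_self] at hSR
    linarith
  have h12 := h.dist_proj_mem hS.1.1 x₀ (h.mem hS.1.1 z)
  have h13 : 0 < dist p (pr S z) := by
    rw [dist_pos]
    rw [hup] at hu
    exact Ne.symm hu
  rcases h.le_or_le hS.1.1 hQ' hSQ' hu0 (hp ▸ hz) with h14 | h14
  · rw [← hp] at h14
    rw [hup, dist_self] at h2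
    linarith
  · rw [hup] at hSR hSu
    linarith [dist_nonneg (x := p) (y := pr Q' z)]

theorem isAttached (h : IsProjectionSystem PX pr) (hx₀ : {x₀} ∈ PX) (hr : 0 < r) (hR : 2 * r ≤ R)
    (hQ : IsLastAnchor PX pr x₀ R Q z) (hQ' : IsLastAnchor PX pr x₀ R Q' z')
    (hd : dist z z' < r) (hne : Q ≠ Q') (heq : pr Q z' = pr Q z) :
    IsAttached PX pr x₀ r R Q z Q' z' := by
  have hR0 : 0 < R := by linarith
  have hQz' : Q ∈ anchors PX pr x₀ R z' := ⟨hQ.1.1, by rw [heq]; exact hQ.1.2⟩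
  have hle := hQ'.2 Q hQz' hne
  rw [heq] at hle
  have hQy := h.dist_proj_mem hQ.1.1 x₀ (h.mem hQ.1.1 z)
  have hQy' := h.dist_proj_mem hQ'.1.1 x₀ (h.mem hQ'.1.1 z')
  have hnn := dist_nonneg (x := pr Q x₀) (y := pr Q z)
  have hroot : Q' ≠ {x₀} := by
    rintro rfl
    rw [h.proj_singleton hQ'.1.1, dist_self] at hle
    rcases hQ.1.2 with e | e
    · exact hne e
    · linarith [dist_nonneg (x := x₀) (y := pr Q x₀)]
  have hR' : R ≤ dist (pr Q' x₀) (pr Q' z') := hQ'.1.2.resolve_left hroot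
  have hz' := h.dist_eq_of_mem_anchors hR0 hQ'.1
  have hzz := h.dist_eq_of_mem_anchors hR0 hQ.1
  have hzz' := h.dist_eq_of_mem_anchors hR0 hQz'
  rw [heq] at hzz'
  have hv : pr Q' z ≠ pr Q' z' := by
    intro e
    have := hQ.2 Q' ⟨hQ'.1.1, Or.inr (by rw [e]; exact hR')⟩ hne.symm
    rw [e] at this
    linarith
  have hsplit := h.dist_eq_of_ne hQ'.1.1 hv
  have n1 := dist_nonneg (x := z) (y := pr Q' z)
  have n2 := dist_nonneg (x := pr Q' z) (y := pr Q' z')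
  have n3 := dist_nonneg (x := pr Q' z') (y := z')
  have ht := dist_triangle (pr Q' x₀) (pr Q' z) (pr Q' z')
  have hvR : dist (pr Q' x₀) (pr Q' z) < R := by
    by_contra hge
    have := hQ.2 Q' ⟨hQ'.1.1, Or.inr (not_lt.1 hge)⟩ hne.symm
    have h4 := h.dist_proj_mem hQ'.1.1 x₀ (h.mem hQ'.1.1 z)
    linarith
  have hvne : pr Q' x₀ ≠ pr Q' z := by
    rw [← dist_pos]
    linarith
  have hzv := h.dist_eq_of_ne hQ'.1.1 hvne
  rw [dist_comm (pr Q' z) z] at hzv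
  have hproj : pr Q (pr Q' x₀) = pr Q z := by
    by_contra hcon
    have h1 : pr Q (pr Q' x₀) ≠ pr Q z' := by rwa [heq]
    have h2 := h.dist_eq_of_ne hQ.1.1 h1
    rw [heq] at h2
    have h3 := dist_triangle (pr Q' x₀) (pr Q' z') z'
    have h4 := dist_pos.2 hcon
    linarith [dist_nonneg (x := pr Q' x₀) (y := pr Q (pr Q' x₀))]
  refine ⟨h.isLastAnchor_entrance hx₀ hR0 hQ hQ'.1.1 hvne.symm hproj, hproj, hroot,
    by linarith, ?_, by linarith⟩
  rw [abs_le]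
  constructor <;> linarith

/-- The possible relative positions of two points at distance less than `r`. -/
theorem dist_lt_cases (h : IsProjectionSystem PX pr) (hx₀ : {x₀} ∈ PX) (hr : 0 < r) (hR : 2 * r ≤ R)
    (hQ : IsLastAnchor PX pr x₀ R Q z) (hQ' : IsLastAnchor PX pr x₀ R Q' z')
    (hd : dist z z' < r) :
    (Q = Q' ∧ pr Q z = pr Q' z') ∨
    (Q = Q' ∧ dist (pr Q z) z + dist (pr Q z) (pr Q' z') + dist (pr Q' z') z' < r) ∨
    IsAttached PX pr x₀ r R Q z Q' z' ∨ IsAttached PX pr x₀ r R Q' z' Q z := by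
  have hR0 : 0 < R := by linarith
  by_cases hne : Q = Q'
  · subst hne
    by_cases he : pr Q z = pr Q z'
    · exact Or.inl ⟨rfl, he⟩
    · right; left
      rw [h.dist_eq_of_ne hQ.1.1 he] at hd
      exact ⟨rfl, by rwa [dist_comm _ z]⟩
  right; right
  by_cases h1 : pr Q z' = pr Q z
  · exact Or.inl (h.isAttached hx₀ hr hR hQ hQ' hd hne h1)
  by_cases h2 : pr Q' z = pr Q' z'
  · exact Or.inr (h.isAttached hx₀ hr hR hQ' hQ (by rwa [dist_comm]) (Ne.symm hne) h2)
  exfalso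
  have hroot : ∀ {S : Set X} {u v : X}, S ∈ PX → pr S u ≠ pr S v → S ≠ {x₀} := by
    rintro S u v hS huv rfl
    exact huv (by rw [h.proj_singleton hS, h.proj_singleton hS])
  have hRQ : R ≤ dist (pr Q x₀) (pr Q z) := hQ.1.2.resolve_left (hroot hQ.1.1 h1)
  have hRQ' : R ≤ dist (pr Q' x₀) (pr Q' z') := hQ'.1.2.resolve_left (hroot hQ'.1.1 h2)
  have d1 := h.dist_eq_of_ne hQ.1.1 (Ne.symm h1)
  have d2 := h.dist_eq_of_ne hQ'.1.1 h2
  have t1 := dist_triangle_right (pr Q x₀) (pr Q z) (pr Q z')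
  have t2 := dist_triangle (pr Q' x₀) (pr Q' z) (pr Q' z')
  have m1 := h.dist_proj_mem hQ.1.1 x₀ (h.mem hQ.1.1 z)
  have m2 := h.dist_proj_mem hQ.1.1 x₀ (h.mem hQ.1.1 z')
  have m3 := h.dist_proj_mem hQ'.1.1 x₀ (h.mem hQ'.1.1 z)
  have m4 := h.dist_proj_mem hQ'.1.1 x₀ (h.mem hQ'.1.1 z')
  have n1 := dist_nonneg (x := z) (y := pr Q z)
  have n2 := dist_nonneg (x := pr Q z) (y := pr Q z')
  have n3 := dist_nonneg (x := pr Q z') (y := z')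
  have n4 := dist_nonneg (x := z) (y := pr Q' z)
  have n5 := dist_nonneg (x := pr Q' z) (y := pr Q' z')
  have n6 := dist_nonneg (x := pr Q' z') (y := z')
  have ne1 : pr Q z ≠ pr Q x₀ := (dist_pos.1 (hR0.trans_le hRQ)).symm
  have ne2 : pr Q' z' ≠ pr Q' x₀ := (dist_pos.1 (hR0.trans_le hRQ')).symm
  have ne3 : pr Q z' ≠ pr Q x₀ := by
    symm; rw [← dist_pos]; linarith
  have ne4 : pr Q' z ≠ pr Q' x₀ := by
    symm; rw [← dist_pos]; linarith
  have e1 := h.dist_eq_of_ne hQ.1.1 ne1.symm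
  have e2 := h.dist_eq_of_ne hQ'.1.1 ne2.symm
  have e3 := h.dist_eq_of_ne hQ.1.1 ne3.symm
  have e4 := h.dist_eq_of_ne hQ'.1.1 ne4.symm
  rw [dist_comm (pr Q z) z] at e1
  rw [dist_comm (pr Q' z) z] at e4
  rcases h.le_or_le hQ.1.1 hQ'.1.1 hne ne1 ne4 with o1 | o1
  · linarith
  rcases h.le_or_le hQ.1.1 hQ'.1.1 hne ne3 ne2 with o2 | o2
  · linarith
  · linarith

end IsProjectionSystem

end Projections

section Colorings

open Relation

variable {Y : Type*} {d : Y → Y → ℝ} {n : ℕ} {s M : ℝ}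

theorem isDChain_iff {S : Set Y} {x y : Y} :
    IsDChain d s S x y ↔ x ∈ S ∧ ReflTransGen (fun a b => a ∈ S ∧ b ∈ S ∧ d a b < s) x y := by
  constructor
  · rintro ⟨m, c, rfl, rfl, hS, hd⟩
    refine ⟨hS 0 (Nat.zero_le m), ?_⟩
    have : ∀ i ≤ m, ReflTransGen (fun a b => a ∈ S ∧ b ∈ S ∧ d a b < s) (c 0) (c i) := by
      intro i
      induction i with
      | zero => exact fun _ => .refl
      | succ i ih =>
        exact fun hi => (ih (by omega)).tail ⟨hS _ (by omega), hS _ hi, hd _ (by omega)⟩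
    exact this m le_rfl
  · rintro ⟨hx, hxy⟩
    induction hxy with
    | refl => exact ⟨0, fun _ => x, rfl, rfl, fun _ _ => hx, fun i hi => by omega⟩
    | @tail b z _ hbz ih =>
      obtain ⟨m, c, h0, hm, hS, hd⟩ := ih
      refine ⟨m + 1, fun i => if i ≤ m then c i else z, by simpa using h0, by simp, ?_, ?_⟩
      · intro i _
        dsimp only
        split_ifs with hi
        · exact hS i hi
        · exact hbz.2.1
      · intro i hi
        have hi' : i ≤ m := by omega
        simp only [hi', if_true]
        split_ifs with h1
        · exact hd i (by omega)
        · rw [show i = m by omega, hm]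
          exact hbz.2.2

/-- A dimension bound at a given scale provides a colouring whose monochromatic chains are
bounded. -/
theorem DimLeAtScale.exists_coloring (hd : ∀ x y, d x y = d y x) (h : DimLeAtScale d n s M) :
    ∃ c : Y → Fin (n + 1),
      ∀ x y, ReflTransGen (fun a b => d a b < s ∧ c a = c b) x y → d x y ≤ M := by
  obtain ⟨U, hU, hM⟩ := h
  choose c hc using hU
  refine ⟨c, fun x y hxy => ?_⟩
  set C : Set Y :=
    {z | ReflTransGen (fun a b => a ∈ U (c x) ∧ b ∈ U (c x) ∧ d a b < s) x z} with hC
  have hsymm : Std.Symm (fun a b => a ∈ U (c x) ∧ b ∈ U (c x) ∧ d a b < s) :=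
    ⟨fun a b hab => ⟨hab.2.1, hab.1, hd a b ▸ hab.2.2⟩⟩
  have hCU : C ⊆ U (c x) := by
    intro z hz
    rcases ReflTransGen.cases_tail hz with rfl | ⟨_, _, h1⟩
    · exact hc _
    · exact h1.2.1
  have hcomp : IsDComponent d s (U (c x)) C := by
    refine ⟨hCU, ?_, ?_⟩
    · intro a ha b hb
      refine isDChain_iff.2 ⟨ha, ?_⟩
      have hab := (ReflTransGen.stdSymm.symm _ _ ha).trans hb
      clear hb
      induction hab with
      | refl => exact .refl
      | tail h1 h2 ih =>
        have h3 := ReflTransGen.trans ha h1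
        exact ih.tail ⟨h3, h3.tail h2, h2.2.2⟩
    · intro C' hCC' hC'U hC'
      refine hCC'.antisymm fun z hz => ?_
      have h1 := (isDChain_iff.1 (hC' x (hCC' .refl) z hz)).2
      exact ReflTransGen.mono (fun a b hab => ⟨hC'U hab.1, hC'U hab.2.1, hab.2.2⟩) _ _ h1
  refine hM _ C hcomp x .refl y ?_
  have : c y = c x ∧ y ∈ C := by
    induction hxy with
    | refl => exact ⟨rfl, .refl⟩
    | @tail a b _ h2 ih =>
      have hb : c b = c x := h2.2.symm.trans ih.1
      exact ⟨hb, ReflTransGen.tail ih.2 ⟨hCU ih.2, hb ▸ hc b, h2.1⟩⟩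
  exact this.2

theorem DimLeAtScale.of_coloring (c : Y → Fin (n + 1))
    (hc : ∀ x y, ReflTransGen (fun a b => d a b < s ∧ c a = c b) x y → d x y ≤ M) :
    DimLeAtScale d n s M := by
  refine ⟨fun i => {y | c y = i}, fun y => ⟨c y, rfl⟩, fun i C hC x hx y hy => hc x y ?_⟩
  exact ReflTransGen.mono (fun a b hab =>
    ⟨hab.2.2, (hC.1 hab.1 : c a = i).trans (hC.1 hab.2.1 : c b = i).symm⟩) _ _
    (isDChain_iff.1 (hC.2.1 x hx y hy)).2

theorem SetDimLeAtScale.exists_coloring {X : Type*} [MetricSpace X] {P : Set X}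
    (h : SetDimLeAtScale P n s M) :
    ∃ c : X → Fin (n + 1), ∀ x ∈ P, ∀ y,
      ReflTransGen (fun a b => a ∈ P ∧ b ∈ P ∧ dist a b < s ∧ c a = c b) x y → dist x y ≤ M := by
  classical
  obtain ⟨c, hc⟩ := DimLeAtScale.exists_coloring (fun _ _ => dist_comm _ _) h
  refine ⟨fun x => if hx : x ∈ P then c ⟨x, hx⟩ else 0, fun x hx y hxy => ?_⟩
  suffices ∃ hy : y ∈ P, ReflTransGen (fun a b : P => dist (a : X) b < s ∧ c a = c b)
      ⟨x, hx⟩ ⟨y, hy⟩ from hc _ _ this.2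
  induction hxy with
  | refl => exact ⟨hx, .refl⟩
  | tail _ h2 ih =>
    obtain ⟨hb, ih⟩ := ih
    refine ⟨h2.2.1, ih.tail ⟨h2.2.2.1, ?_⟩⟩
    have := h2.2.2.2
    dsimp only at this
    rwa [dif_pos hb, dif_pos h2.2.1] at this

/-- The sequence of colours starting with `i` and going on with alternating values. -/
def alternate (i : Fin (n + 1)) : ℕ → Fin (n + 1)
  | 0 => i
  | k + 1 => if alternate i k = 0 then Fin.last n else 0

theorem alternate_succ_ne (hn : 0 < n) (i : Fin (n + 1)) (k : ℕ) :
    alternate i (k + 1) ≠ alternate i k := by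
  rw [alternate]
  split_ifs with h0
  · rw [h0]
    exact fun h1 => hn.ne' (congrArg Fin.val h1)
  · exact Ne.symm h0

theorem floor_eq_of_alternate_eq (hn : 0 < n) {i : Fin (n + 1)} {x y w : ℝ}
    (hxy : |x - y| < w) (h : alternate i ⌊x / w⌋₊ = alternate i ⌊y / w⌋₊) :
    ⌊x / w⌋₊ = ⌊y / w⌋₊ := by
  have hw : 0 < w := (abs_nonneg _).trans_lt hxy
  have key : ∀ {a b : ℝ}, a - b < w → ⌊a / w⌋₊ ≤ ⌊b / w⌋₊ + 1 := by
    intro a b hab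
    rcases le_or_gt 0 (b / w) with hb | hb
    · rw [← Nat.floor_add_one hb]
      apply Nat.floor_le_floor
      rw [div_add_one hw.ne']
      exact div_le_div_of_nonneg_right (by linarith) hw.le
    · have : a / w < 1 := by
        rw [div_lt_one hw]
        have := (div_neg_iff.1 hb).resolve_left (by rintro ⟨_, h1⟩; linarith)
        linarith [this.1]
      rw [Nat.floor_eq_zero.2 this]
      exact Nat.zero_le _
  have h1 := key (abs_lt.1 hxy).2
  have h2 := key (a := y) (b := x) (by linarith [(abs_lt.1 hxy).1])
  rcases Nat.lt_trichotomy ⌊x / w⌋₊ ⌊y / w⌋₊ with h3 | h3 | h3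
  · rw [show ⌊y / w⌋₊ = ⌊x / w⌋₊ + 1 by omega] at h
    exact absurd h.symm (alternate_succ_ne hn _ _)
  · exact h3
  · rw [show ⌊x / w⌋₊ = ⌊y / w⌋₊ + 1 by omega] at h
    exact absurd h (alternate_succ_ne hn _ _)

end Colorings

section TreeColoring

open Relation

variable {X : Type*} [MetricSpace X] {PX : Set (Set X)} {pr : Set X → X → X} {x₀ : X} {r fr : ℝ}
  {L : X → Set X} {n : ℕ} {c : Set X → X → Fin (n + 1)}

/-- A choice `L z` of the last anchor of every point `z`. -/
structure IsAnchorChoice (PX : Set (Set X)) (pr : Set X → X → X) (x₀ : X) (r : ℝ)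
    (L : X → Set X) : Prop where
  proj : IsProjectionSystem PX pr
  root : {x₀} ∈ PX
  pos : 0 < r
  last : ∀ z, IsLastAnchor PX pr x₀ (4 * r) (L z) z

/-- The index of the annulus of width `3 * r` about its projection to `L z` containing `z`. -/
noncomputable def bandIndex (pr : Set X → X → X) (L : X → Set X) (r : ℝ) (z : X) : ℕ :=
  ⌊dist (pr (L z) z) z / (3 * r)⌋₊

/-- The colour of `z`: the colour of its projection to `L z` in the first annulus, followed by
alternating colours. -/
noncomputable def treeColor (c : Set X → X → Fin (n + 1)) (pr : Set X → X → X) (L : X → Set X)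
    (r : ℝ) (z : X) : Fin (n + 1) :=
  alternate (c (L z) (pr (L z) z)) (bandIndex pr L r z)

/-- Two points of the same colour at distance less than `r`. -/
def IsNext (c : Set X → X → Fin (n + 1)) (pr : Set X → X → X) (L : X → Set X) (r : ℝ)
    (a b : X) : Prop :=
  dist a b < r ∧ treeColor c pr L r a = treeColor c pr L r b

/-- `z` lies in the annulus of index `k` about the point `y` of `Q`. -/
def InBand (pr : Set X → X → X) (L : X → Set X) (r : ℝ) (Q : Set X) (y : X) (k : ℕ) (z : X) :
    Prop :=
  L z = Q ∧ pr (L z) z = y ∧ bandIndex pr L r z = k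

/-- `z` lies in a first annulus about a piece whose entrance is close to the given annulus. -/
structure IsNearBand (c : Set X → X → Fin (n + 1)) (pr : Set X → X → X) (L : X → Set X) (x₀ : X)
    (r : ℝ) (Q : Set X) (y : X) (k : ℕ) (z : X) : Prop where
  band : bandIndex pr L r z = 0
  ne : L z ≠ {x₀}
  anchor : L (pr (L z) x₀) = Q
  proj : pr Q (pr (L z) x₀) = y
  color : treeColor c pr L r z = alternate (c Q y) k
  height : ∃ z₁, InBand pr L r Q y k z₁ ∧
    |dist x₀ z₁ - (dist x₀ (pr (L z) x₀) + 4 * r)| ≤ r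

theorem IsNext.symm {a b : X} (h : IsNext c pr L r a b) : IsNext c pr L r b a :=
  ⟨dist_comm a b ▸ h.1, h.2.symm⟩

theorem reflTransGen_isNext_symm {a b : X} (h : ReflTransGen (IsNext c pr L r) a b) :
    ReflTransGen (IsNext c pr L r) b a :=
  haveI : Std.Symm (IsNext c pr L r) := ⟨fun _ _ => IsNext.symm⟩
  ReflTransGen.stdSymm.symm _ _ h

theorem bandIndex_eq_of_treeColor_eq (hn : 0 < n) {z z' : X}
    (hc : c (L z) (pr (L z) z) = c (L z') (pr (L z') z'))
    (hd : |dist (pr (L z) z) z - dist (pr (L z') z') z'| < 3 * r)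
    (hcol : treeColor c pr L r z = treeColor c pr L r z') :
    bandIndex pr L r z = bandIndex pr L r z' := by
  rw [treeColor, treeColor, ← hc] at hcol
  exact floor_eq_of_alternate_eq hn hd hcol

namespace IsAnchorChoice

variable {z z' y : X} {Q P : Set X} {k : ℕ}

theorem dist_eq (h : IsAnchorChoice PX pr x₀ r L)
    (z : X) : dist x₀ z = dist x₀ (pr (L z) z) + dist (pr (L z) z) z :=
  h.proj.dist_eq_of_mem_anchors (by linarith [h.pos]) (h.last z).1

theorem le_dist (h : IsAnchorChoice PX pr x₀ r L)
    : bandIndex pr L r z * (3 * r) ≤ dist (pr (L z) z) z := by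
  have hr := h.pos
  rw [← le_div_iff₀ (by linarith)]
  exact Nat.floor_le (by positivity)

theorem dist_lt (h : IsAnchorChoice PX pr x₀ r L)
    : dist (pr (L z) z) z < (bandIndex pr L r z + 1) * (3 * r) := by
  have hr := h.pos
  rw [← div_lt_iff₀ (by linarith)]
  exact Nat.lt_floor_add_one _

theorem bandIndex_eq_zero (h : IsAnchorChoice PX pr x₀ r L)
    (hz : dist (pr (L z) z) z < 3 * r) : bandIndex pr L r z = 0 := by
  have hr := h.pos
  rw [bandIndex, Nat.floor_eq_zero, div_lt_one (by linarith)]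
  exact hz

theorem bandIndex_pos (h : IsAnchorChoice PX pr x₀ r L)
    (hz : 3 * r ≤ dist (pr (L z) z) z) : 0 < bandIndex pr L r z := by
  have hr := h.pos
  rw [bandIndex, Nat.floor_pos, one_le_div (by linarith)]
  exact hz

theorem isNext_cases (h : IsAnchorChoice PX pr x₀ r L) (hn : 0 < n) (hz : IsNext c pr L r z z') :
    (L z = L z' ∧ pr (L z) z = pr (L z') z' ∧ bandIndex pr L r z = bandIndex pr L r z') ∨
    (L z = L z' ∧ bandIndex pr L r z = 0 ∧ bandIndex pr L r z' = 0 ∧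
      dist (pr (L z) z) (pr (L z') z') < r ∧
      c (L z) (pr (L z) z) = c (L z') (pr (L z') z')) ∨
    (IsAttached PX pr x₀ r (4 * r) (L z) z (L z') z' ∧ 0 < bandIndex pr L r z ∧
      bandIndex pr L r z' = 0) ∨
    (IsAttached PX pr x₀ r (4 * r) (L z') z' (L z) z ∧ 0 < bandIndex pr L r z' ∧
      bandIndex pr L r z = 0) := by
  have hr := h.pos
  have hatt : ∀ {a b}, IsAttached PX pr x₀ r (4 * r) (L a) a (L b) b →
      0 < bandIndex pr L r a ∧ bandIndex pr L r b = 0 := fun hab =>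
    ⟨h.bandIndex_pos (by linarith [hab.far]), h.bandIndex_eq_zero (by linarith [hab.near])⟩
  rcases h.proj.dist_lt_cases h.root hr (by linarith) (h.last z) (h.last z') hz.1 with
    ⟨h1, h2⟩ | ⟨h1, h2⟩ | h1 | h1
  · refine Or.inl ⟨h1, h2, bandIndex_eq_of_treeColor_eq hn (by rw [h2, h1]) ?_ hz.2⟩
    rw [abs_lt]
    have t1 := dist_triangle (pr (L z) z) z z'
    have t2 := dist_triangle_right (pr (L z) z) z z'
    have hd := hz.1
    rw [← h2]
    constructor <;> linarith
  · have n1 := dist_nonneg (x := pr (L z) z) (y := z)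
    have n2 := dist_nonneg (x := pr (L z) z) (y := pr (L z') z')
    have n3 := dist_nonneg (x := pr (L z') z') (y := z')
    have k1 := h.bandIndex_eq_zero (z := z) (by linarith)
    have k2 := h.bandIndex_eq_zero (z := z') (by linarith)
    have hc := hz.2
    rw [treeColor, treeColor, k1, k2] at hc
    exact Or.inr (Or.inl ⟨h1, k1, k2, by linarith, hc⟩)
  · exact Or.inr (Or.inr (Or.inl ⟨h1, hatt h1⟩))
  · exact Or.inr (Or.inr (Or.inr ⟨h1, hatt h1⟩))

theorem isLastAnchor_eq (h : IsAnchorChoice PX pr x₀ r L)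
    (hQ : IsLastAnchor PX pr x₀ (4 * r) Q z) : L z = Q :=
  h.proj.isLastAnchor_unique (by linarith [h.pos]) (h.last z) hQ

theorem inBand_or_isNearBand_of_isNext (h : IsAnchorChoice PX pr x₀ r L) (hn : 0 < n) (hk : 0 < k)
    (hz : InBand pr L r Q y k z ∨ IsNearBand c pr L x₀ r Q y k z) (hzz : IsNext c pr L r z z') :
    InBand pr L r Q y k z' ∨ IsNearBand c pr L x₀ r Q y k z' := by
  have hr := h.pos
  rcases hz with ⟨rfl, rfl, rfl⟩ | hz
  · rcases h.isNext_cases hn hzz with h1 | h1 | ⟨h1, h2, h3⟩ | h1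
    · exact Or.inl ⟨h1.1.symm, h1.2.1.symm, h1.2.2.symm⟩
    · omega
    · exact Or.inr ⟨h3, h1.ne, h.isLastAnchor_eq h1.last, h1.proj_eq, hzz.2.symm, z,
        ⟨rfl, rfl, rfl⟩, h1.height⟩
    · omega
  · have key : L z = L z' → bandIndex pr L r z' = 0 → IsNearBand c pr L x₀ r Q y k z' := by
      intro hL h0
      have := hz.color
      obtain ⟨_, h1, h2, h3, _, h5⟩ := hz
      rw [hL] at h1 h2 h3 h5
      exact ⟨h0, h1, h2, h3, hzz.2.symm.trans this, h5⟩
    have hb := hz.band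
    rcases h.isNext_cases hn hzz with h1 | h1 | ⟨h1, h2, h3⟩ | ⟨h1, h2, h3⟩
    · exact Or.inr (key h1.1 (by omega))
    · exact Or.inr (key h1.1 (by omega))
    · omega
    · obtain ⟨z₁, ⟨e1, e2, e3⟩, h5⟩ := hz.height
      have hL : L z' = Q := (h.isLastAnchor_eq h1.last).symm.trans hz.anchor
      have hy : pr (L z') z' = y := by rw [← h1.proj_eq, hL, hz.proj]
      refine Or.inl ⟨hL, hy, ?_⟩
      have h6 := h.dist_eq z'
      have h7 := h.dist_eq z₁
      have h8 := abs_le.1 h1.height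
      have h9 := abs_le.1 h5
      rw [e2] at h7
      rw [hy] at h6
      rw [← e3]
      refine bandIndex_eq_of_treeColor_eq hn (c := c) (by rw [e2, e1, hy, hL]) ?_ ?_
      · rw [e2, hy, abs_lt]
        constructor <;> linarith
      · rw [← hzz.2, hz.color, treeColor, e3, e2, e1]

theorem le_dist_of_inBand_or_isNearBand (h : IsAnchorChoice PX pr x₀ r L)
    (hz : InBand pr L r Q y k z ∨ IsNearBand c pr L x₀ r Q y k z) :
    dist x₀ y + k * (3 * r) - r ≤ dist x₀ z := by
  have hr := h.pos
  have key : ∀ {a}, InBand pr L r Q y k a → dist x₀ y + k * (3 * r) ≤ dist x₀ a := by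
    rintro a ⟨rfl, rfl, rfl⟩
    linarith [h.dist_eq a, h.le_dist (z := a)]
  rcases hz with hz | hz
  · linarith [key hz]
  · obtain ⟨z₁, h1, h2⟩ := hz.height
    have h3 := key h1
    have h4 := h.dist_eq z
    have h5 := h.proj.dist_proj_mem (h.last z).1.1 x₀ (h.proj.mem (h.last z).1.1 z)
    have h6 := (h.last z).1.2.resolve_left hz.ne
    linarith [(abs_le.1 h2).2, dist_nonneg (x := pr (L z) z) (y := z)]

/-- Points of a chain starting in an annulus see `x₀` through a common piece. -/
theorem eq_or_exists_piece_of_chain (h : IsAnchorChoice PX pr x₀ r L)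
    (hTG : IsTreeGraded X PX) (hgeo : GeodesicSpace X)
    (hn : 0 < n) (hk : 0 < k) {α : X → ℝ → X} (hα : ∀ z, IsGeodesicFrom (α z) x₀ z)
    (hz : InBand pr L r Q y k z) (hzz : ReflTransGen (IsNext c pr L r) z z') :
    (InBand pr L r Q y k z' ∨ IsNearBand c pr L x₀ r Q y k z') ∧
    (α z (dist x₀ y + k * (3 * r) - 2 * r) = α z' (dist x₀ y + k * (3 * r) - 2 * r) ∨
      ∃ P ∈ PX, α z (dist x₀ y + k * (3 * r) - 2 * r) ∈ P ∧
        α z' (dist x₀ y + k * (3 * r) - 2 * r) ∈ P) := by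
  have hr := h.pos
  obtain ⟨l, hl⟩ : ∃ l, l = dist x₀ y + k * (3 * r) - 2 * r := ⟨_, rfl⟩
  rw [← hl]
  have hk1 : (1 : ℝ) ≤ k := by exact_mod_cast hk
  have hl0 : 0 ≤ l := by
    have : 3 * r ≤ k * (3 * r) := le_mul_of_one_le_left (by linarith) hk1
    rw [hl]
    linarith [dist_nonneg (x := x₀) (y := y)]
  have hdist : ∀ {a}, (InBand pr L r Q y k a ∨ IsNearBand c pr L x₀ r Q y k a) →
      dist x₀ (α a l) = l := fun ha =>
    (hα _).dist_left ⟨hl0, by linarith [h.le_dist_of_inBand_or_isNearBand ha]⟩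
  induction hzz with
  | refl => exact ⟨Or.inl hz, Or.inl rfl⟩
  | @tail a b _ hab ih =>
    have hb := h.inBand_or_isNearBand_of_isNext hn hk ih.1 hab
    refine ⟨hb, h.proj.common_piece_trans (hdist (Or.inl hz)) (hdist ih.1) (hdist hb) ih.2 ?_⟩
    refine hTG.eq_or_exists_piece_of_level hgeo (hα a) (hα b) hl0 fun u hu => ?_
    have h1 := h.le_dist_of_inBand_or_isNearBand ih.1
    have h2 := hab.1
    have h3 := dist_triangle_right x₀ a u
    linarith [dist_nonneg (x := u) (y := b)]

theorem dist_proj_lt_of_level (h : IsAnchorChoice PX pr x₀ r L) {w : X} (hP : P ∈ PX) (hw : w ∈ P)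
    (hwz : dist x₀ w + dist w z = dist x₀ z) (hl : dist x₀ (pr (L z) z) < dist x₀ w) :
    dist (pr P x₀) w < 4 * r := by
  have hr := h.pos
  by_contra! hcon
  have h1 := h.proj.dist_eq hP z w hw
  have h2 := h.proj.dist_proj_mem hP x₀ hw
  have h3 := dist_comm w z
  by_cases hu : pr P z = pr P x₀
  · rw [hu] at h1
    linarith [dist_triangle x₀ (pr P x₀) z, dist_comm (pr P x₀) z]
  have h4 := h.proj.dist_eq_of_ne hP (Ne.symm hu)
  have h5 := h.proj.dist_proj_mem hP x₀ (h.proj.mem hP z)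
  have h6 := dist_comm (pr P z) z
  have h7 := dist_nonneg (x := pr P z) (y := w)
  by_cases hPL : P = L z
  · subst hPL
    linarith
  · have h8 := (h.last z).2 P ⟨hP, Or.inr (by linarith)⟩ hPL
    have h9 := h.proj.dist_proj_mem (h.last z).1.1 x₀ (h.proj.mem (h.last z).1.1 z)
    linarith [dist_nonneg (x := pr (L z) x₀) (y := pr (L z) z)]

theorem dist_le_of_chain_of_pos (h : IsAnchorChoice PX pr x₀ r L)
    (hTG : IsTreeGraded X PX) (hgeo : GeodesicSpace X)
    (hn : 0 < n) (hzz : ReflTransGen (IsNext c pr L r) z z') (hk : 0 < bandIndex pr L r z)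
    (hk' : 0 < bandIndex pr L r z') : dist z z' ≤ 18 * r := by
  have hr := h.pos
  choose α hα using fun z => hgeo x₀ z
  obtain ⟨hz', hW⟩ := h.eq_or_exists_piece_of_chain hTG hgeo hn hk hα ⟨rfl, rfl, rfl⟩ hzz
  have hb := hz'.resolve_right fun h1 => hk'.ne' h1.band
  have hk1 : (1 : ℝ) ≤ bandIndex pr L r z := by exact_mod_cast hk
  have hkr : 3 * r ≤ bandIndex pr L r z * (3 * r) := le_mul_of_one_le_left (by linarith) hk1
  have e1 := h.dist_eq z
  have e2 := h.dist_eq z'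
  have a1 := h.le_dist (z := z)
  have a2 := h.le_dist (z := z')
  have b1 := h.dist_lt (z := z)
  have b2 := h.dist_lt (z := z')
  rw [hb.2.1] at e2 a2 b2
  rw [hb.2.2] at a2 b2
  obtain ⟨l, hl⟩ : ∃ l, l = dist x₀ (pr (L z) z) + bandIndex pr L r z * (3 * r) - 2 * r :=
    ⟨_, rfl⟩
  rw [← hl] at hW
  have n0 := dist_nonneg (x := x₀) (y := pr (L z) z)
  have m1 : l ∈ Icc 0 (dist x₀ z) := ⟨by linarith, by linarith⟩
  have m2 : l ∈ Icc 0 (dist x₀ z') := ⟨by linarith, by linarith⟩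
  have l1 := IsGeodesicFrom.dist_left (hα z) m1
  have l2 := IsGeodesicFrom.dist_left (hα z') m2
  have r1 := IsGeodesicFrom.dist_right (hα z) m1
  have r2 := IsGeodesicFrom.dist_right (hα z') m2
  have hWW : dist (α z l) (α z' l) ≤ 8 * r := by
    rcases hW with hW | ⟨P, hP, h1, h2⟩
    · rw [hW, dist_self]
      linarith
    · have h3 := h.dist_proj_lt_of_level hP h1 (by linarith) (by linarith)
      have h4 := h.dist_proj_lt_of_level hP h2 (by linarith) (by rw [hb.2.1]; linarith)
      linarith [dist_triangle_left (α z l) (α z' l) (pr P x₀)]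
  have t1 := dist_triangle z (α z l) z'
  have t2 := dist_triangle (α z l) (α z' l) z'
  rw [dist_comm z (α z l)] at t1
  linarith

/-- A chain of points in the first annuli projects to a chain in a piece. -/
theorem proj_chain (h : IsAnchorChoice PX pr x₀ r L) (hn : 0 < n)
    (hzz : ReflTransGen (fun a b => IsNext c pr L r a b ∧ bandIndex pr L r a = 0 ∧
      bandIndex pr L r b = 0) z z') :
    L z = L z' ∧ ReflTransGen (fun a b => a ∈ L z ∧ b ∈ L z ∧ dist a b < r ∧
      c (L z) a = c (L z) b) (pr (L z) z) (pr (L z') z') := by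
  induction hzz with
  | refl => exact ⟨rfl, .refl⟩
  | @tail a b _ hab ih =>
    obtain ⟨hL, ih⟩ := ih
    have ha := h.proj.mem (h.last a).1.1 a
    have hb := h.proj.mem (h.last b).1.1 b
    rcases h.isNext_cases hn hab.1 with h1 | h1 | h1 | h1
    · refine ⟨hL.trans h1.1, ?_⟩
      rwa [← h1.2.1]
    · have hLb := hL.trans h1.1
      have hc := h1.2.2.2.2
      rw [← hL] at ha
      rw [← hLb] at hb
      refine ⟨hLb, ih.tail ⟨hL ▸ ha, hLb ▸ hb, h1.2.2.2.1, ?_⟩⟩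
      simpa only [← hL, ← hLb] using hc
    · have := hab.2.1
      omega
    · have := hab.2.2
      omega

theorem dist_le_of_zero_chain (h : IsAnchorChoice PX pr x₀ r L) (hn : 0 < n)
    (hc : ∀ P ∈ PX, ∀ x ∈ P, ∀ y, ReflTransGen (fun a b => a ∈ P ∧ b ∈ P ∧ dist a b < r ∧
      c P a = c P b) x y → dist x y ≤ fr)
    (hz : bandIndex pr L r z = 0) (hz' : bandIndex pr L r z' = 0)
    (hzz : ReflTransGen (fun a b => IsNext c pr L r a b ∧ bandIndex pr L r a = 0 ∧
      bandIndex pr L r b = 0) z z') : dist z z' ≤ fr + 6 * r := by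
  have h1 := hc _ (h.last z).1.1 _ (h.proj.mem (h.last z).1.1 z) _ (h.proj_chain hn hzz).2
  have h2 := h.dist_lt (z := z)
  have h3 := h.dist_lt (z := z')
  rw [hz] at h2
  rw [hz'] at h3
  norm_num at h2 h3
  have t1 := dist_triangle z (pr (L z) z) z'
  have t2 := dist_triangle (pr (L z) z) (pr (L z') z') z'
  rw [dist_comm z (pr (L z) z)] at t1
  linarith

theorem dist_le_or_exists (h : IsAnchorChoice PX pr x₀ r L) (hn : 0 < n) (hfr : 0 ≤ fr)
    (hc : ∀ P ∈ PX, ∀ x ∈ P, ∀ y, ReflTransGen (fun a b => a ∈ P ∧ b ∈ P ∧ dist a b < r ∧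
      c P a = c P b) x y → dist x y ≤ fr)
    (hzz : ReflTransGen (IsNext c pr L r) z z') :
    dist z z' ≤ fr + 6 * r ∨ ∃ b, 0 < bandIndex pr L r b ∧
      ReflTransGen (IsNext c pr L r) b z' ∧ dist z b ≤ fr + 7 * r := by
  have hr := h.pos
  rcases Nat.eq_zero_or_pos (bandIndex pr L r z) with hz | hz
  swap
  · exact Or.inr ⟨z, hz, hzz, by rw [dist_self]; linarith⟩
  have key : (ReflTransGen (fun a b => IsNext c pr L r a b ∧ bandIndex pr L r a = 0 ∧
        bandIndex pr L r b = 0) z z' ∧ bandIndex pr L r z' = 0) ∨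
      ∃ a b, ReflTransGen (fun a b => IsNext c pr L r a b ∧ bandIndex pr L r a = 0 ∧
        bandIndex pr L r b = 0) z a ∧ bandIndex pr L r a = 0 ∧ dist a b < r ∧
        0 < bandIndex pr L r b ∧ ReflTransGen (IsNext c pr L r) b z' := by
    induction hzz using ReflTransGen.head_induction_on with
    | refl => exact Or.inl ⟨.refl, hz⟩
    | @head u v huv hv ih =>
      rcases Nat.eq_zero_or_pos (bandIndex pr L r v) with h0 | h0
      · rcases ih h0 with ⟨h1, h2⟩ | ⟨a, b, h1, h2⟩
        · exact Or.inl ⟨h1.head ⟨huv, hz, h0⟩, h2⟩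
        · exact Or.inr ⟨a, b, h1.head ⟨huv, hz, h0⟩, h2⟩
      · exact Or.inr ⟨u, v, .refl, hz, huv.1, h0, hv⟩
  rcases key with ⟨h1, h2⟩ | ⟨a, b, h1, h2, h3, h4, h5⟩
  · exact Or.inl (h.dist_le_of_zero_chain hn hc hz h2 h1)
  · have h6 := h.dist_le_of_zero_chain hn hc hz h2 h1
    exact Or.inr ⟨b, h4, h5, by linarith [dist_triangle z a b]⟩

theorem dist_le_of_chain (h : IsAnchorChoice PX pr x₀ r L)
    (hTG : IsTreeGraded X PX) (hgeo : GeodesicSpace X) (hn : 0 < n)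
    (hfr : 0 ≤ fr)
    (hc : ∀ P ∈ PX, ∀ x ∈ P, ∀ y, ReflTransGen (fun a b => a ∈ P ∧ b ∈ P ∧ dist a b < r ∧
      c P a = c P b) x y → dist x y ≤ fr)
    (hzz : ReflTransGen (IsNext c pr L r) z z') : dist z z' ≤ 2 * fr + 32 * r := by
  have hr := h.pos
  rcases h.dist_le_or_exists hn hfr hc hzz with h1 | ⟨b, hb, hbz, h1⟩
  · linarith
  rcases h.dist_le_or_exists hn hfr hc (reflTransGen_isNext_symm hbz) with h2 | ⟨b', hb', hbb, h2⟩
  · linarith [dist_triangle_right z z' b]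
  · have h3 := h.dist_le_of_chain_of_pos hTG hgeo hn hbb hb' hb
    have t1 := dist_triangle_right z z' b
    have t2 := dist_triangle z' b' b
    linarith

end IsAnchorChoice

end TreeColoring

/-- One-point subsets may be added to the pieces. -/
theorem IsTreeGraded.insert_singleton {X : Type*} [MetricSpace X] {PX : Set (Set X)}
    (hTG : IsTreeGraded X PX) (x₀ : X) : IsTreeGraded X (insert {x₀} PX) where
  nonempty := by
    rintro P (rfl | hP)
    · exact singleton_nonempty _
    · exact hTG.nonempty P hP
  closed := by
    rintro P (rfl | hP)
    · exact isClosed_singleton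
    · exact hTG.closed P hP
  geodesicSub := by
    rintro P (rfl | hP)
    · rintro x hx y hy
      obtain rfl : x = x₀ := hx
      obtain rfl : y = x := hy
      refine ⟨fun _ => y, ?_, rfl, rfl, fun _ _ => rfl⟩
      intro s hs t ht
      rw [dist_self, Icc_self, mem_singleton_iff] at hs ht
      simp [hs, ht]
    · exact hTG.geodesicSub P hP
  covers x := by
    obtain ⟨P, hP, hx⟩ := hTG.covers x
    exact ⟨P, Or.inr hP, hx⟩
  t1 := by
    rintro P (rfl | hP) Q (rfl | hQ) hPQ
    · exact absurd rfl hPQ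
    · exact subsingleton_singleton.anti inter_subset_left
    · exact subsingleton_singleton.anti inter_subset_right
    · exact hTG.t1 P hP Q hQ hPQ
  t2 loop hc hi := by
    obtain ⟨P, hP, hl⟩ := hTG.t2 loop hc hi
    exact ⟨P, Or.inr hP, hl⟩

/-- **Main theorem.** If `X` is a geodesic tree-graded space and every piece has
dimension `≤ n` at the scale `r` of magnitude `f(r)`, then `X` has dimension `≤ n`
at the scale `r` of magnitude `300 · f(r)`. -/
theorem treeGraded_dimLeAtScale (X : Type*) [MetricSpace X] [CompleteSpace X]
    (PX : Set (Set X)) (hgeo : GeodesicSpace X) (hTG : IsTreeGraded X PX)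
    (n : ℕ) (hn : 0 < n) (r fr : ℝ) (hr : 0 < r) (hfr : r ≤ fr)
    (hpieces : ∀ P ∈ PX, SetDimLeAtScale P n r fr) :
    DimLeAtScale (dist : X → X → ℝ) n r (300 * fr) := by
  rcases isEmpty_or_nonempty X with hX | ⟨⟨x₀⟩⟩
  · exact ⟨fun _ => ∅, fun y => isEmptyElim y, fun _ _ _ x => isEmptyElim x⟩
  have hTG' := hTG.insert_singleton x₀
  obtain ⟨pr, hpr⟩ := hTG'.exists_projectionSystem hgeo
  have hcol : ∀ P ∈ insert {x₀} PX, ∃ c : X → Fin (n + 1), ∀ x ∈ P, ∀ y,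
      Relation.ReflTransGen (fun a b => a ∈ P ∧ b ∈ P ∧ dist a b < r ∧ c a = c b) x y →
        dist x y ≤ fr := by
    rintro P (rfl | hP)
    · refine ⟨fun _ => 0, fun x hx y hxy => ?_⟩
      rcases Relation.ReflTransGen.cases_tail hxy with rfl | ⟨_, _, h1⟩
      · rw [dist_self]
        linarith
      · rw [mem_singleton_iff.1 hx, mem_singleton_iff.1 h1.2.1, dist_self]
        linarith
    · exact (hpieces P hP).exists_coloring
  choose! c hc using hcol
  choose L hL using hpr.exists_isLastAnchor (mem_insert _ _) (by linarith : 0 < 4 * r)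
  have h : IsAnchorChoice (insert {x₀} PX) pr x₀ r L := ⟨hpr, mem_insert _ _, hr, hL⟩
  refine DimLeAtScale.of_coloring (treeColor c pr L r) fun x y hxy => ?_
  linarith [h.dist_le_of_chain hTG' hgeo hn (by linarith) hc hxy]
end

section
/- Let G and H be finitely generated infinite groups. Then asdim_AN(G*H) = max{asdim_AN(G), asdim_AN(H)}, where G*H is the free product of G and H. -/
section WordMetric

variable {G : Type*} [Group G]

/-- The word length of `g` with respect to the generating set `S`: the least number of
factors from `S ∪ S⁻¹` needed to write `g`. -/
noncomputable def wordLength (S : Set G) (g : G) : ℕ :=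
  sInf {m : ℕ | ∃ l : List G, l.length = m ∧ (∀ x ∈ l, x ∈ S ∨ x⁻¹ ∈ S) ∧ l.prod = g}

/-- The word metric on `G` associated with the generating set `S`. -/
noncomputable def wordDist (S : Set G) (g h : G) : ℝ :=
  (wordLength S (g⁻¹ * h) : ℝ)

end WordMetric

section ANdim

variable {Y : Type*}

/-- `f` is an `n`-dimensional control function: for every scale `s > 0` the space has
dimension `≤ n` at scale `s` of magnitude `f s`. -/
def IsControlFunction (d : Y → Y → ℝ) (n : ℕ) (f : ℝ → ℝ) : Prop :=
  ∀ s : ℝ, 0 < s → DimLeAtScale d n s (f s)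

/-- Asymptotic Assouad–Nagata dimension is at most `n`: there is a linear
`n`-dimensional control function. -/
def ANdimLe (d : Y → Y → ℝ) (n : ℕ) : Prop :=
  ∃ C b : ℝ, 0 < C ∧ 0 < b ∧ IsControlFunction d n (fun s => C * s + b)

/-- The asymptotic Assouad–Nagata dimension: the least `n` admitting a linear
`n`-dimensional control function (`⊤` if there is none). -/
noncomputable def asdimAN (d : Y → Y → ℝ) : ℕ∞ :=
  sInf {N : ℕ∞ | ∃ n : ℕ, N = (n : ℕ∞) ∧ ANdimLe d n}

end ANdim

section WordLength

variable {G : Type*} [Group G] {S : Set G}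

lemma wordLength_le {g : G} {l : List G} (hl : ∀ x ∈ l, x ∈ S ∨ x⁻¹ ∈ S)
    (hg : l.prod = g) : wordLength S g ≤ l.length :=
  Nat.sInf_le ⟨l, rfl, hl, hg⟩

lemma exists_list_length_eq_wordLength (hS : Subgroup.closure S = ⊤) (g : G) :
    ∃ l : List G, l.length = wordLength S g ∧ (∀ x ∈ l, x ∈ S ∨ x⁻¹ ∈ S) ∧ l.prod = g := by
  have hg : g ∈ (Subgroup.closure S).toSubmonoid := by simp [hS]
  rw [Subgroup.closure_toSubmonoid] at hg
  obtain ⟨l, hl, hp⟩ := Submonoid.exists_list_of_mem_closure hg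
  exact Nat.sInf_mem (s := {m : ℕ | ∃ l : List G, l.length = m ∧
    (∀ x ∈ l, x ∈ S ∨ x⁻¹ ∈ S) ∧ l.prod = g}) ⟨l.length, l, rfl, by simpa using hl, hp⟩

lemma wordLength_one : wordLength S (1 : G) = 0 :=
  Nat.le_zero.1 (wordLength_le (l := []) (by simp) (by simp))

lemma wordLength_le_one {g : G} (hg : g ∈ S ∨ g⁻¹ ∈ S) : wordLength S g ≤ 1 :=
  wordLength_le (l := [g]) (by simpa using hg) (by simp)

lemma wordLength_mul_le (hS : Subgroup.closure S = ⊤) (g h : G) :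
    wordLength S (g * h) ≤ wordLength S g + wordLength S h := by
  obtain ⟨l, hl, hlS, rfl⟩ := exists_list_length_eq_wordLength hS g
  obtain ⟨k, hk, hkS, rfl⟩ := exists_list_length_eq_wordLength hS h
  rw [← hl, ← hk, ← List.length_append]
  refine wordLength_le (fun x hx => ?_) (by simp)
  rcases List.mem_append.1 hx with h | h
  exacts [hlS x h, hkS x h]

lemma wordLength_inv_le (hS : Subgroup.closure S = ⊤) (g : G) :
    wordLength S g⁻¹ ≤ wordLength S g := by
  obtain ⟨l, hl, hlS, rfl⟩ := exists_list_length_eq_wordLength hS g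
  rw [← hl, List.prod_inv_reverse]
  refine (wordLength_le (l := (l.map (·⁻¹)).reverse) (fun x hx => ?_) rfl).trans (by simp)
  obtain ⟨y, hy, rfl⟩ : ∃ y ∈ l, y⁻¹ = x := by simpa using hx
  simpa using (hlS y hy).symm

lemma wordLength_inv (hS : Subgroup.closure S = ⊤) (g : G) :
    wordLength S g⁻¹ = wordLength S g :=
  (wordLength_inv_le hS g).antisymm (by simpa using wordLength_inv_le hS g⁻¹)

lemma le_wordLength {f : G → ℕ} (hS : Subgroup.closure S = ⊤) (h1 : f 1 = 0)
    (hf : ∀ s g, s ∈ S ∨ s⁻¹ ∈ S → f (s * g) ≤ f g + 1) (g : G) : f g ≤ wordLength S g := by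
  obtain ⟨l, hl, hlS, rfl⟩ := exists_list_length_eq_wordLength hS g
  rw [← hl]
  clear hl
  induction l with
  | nil => simp [h1]
  | cons a l ih =>
    rw [List.forall_mem_cons] at hlS
    rw [List.prod_cons, List.length_cons]
    exact (hf _ _ hlS.1).trans (by gcongr; exact ih hlS.2)

lemma wordLength_map_le {G' : Type*} [Group G'] {S' : Set G'} (hS : Subgroup.closure S = ⊤)
    (hS' : Subgroup.closure S' = ⊤) (φ : G →* G') (hφ : ∀ s ∈ S, φ s ∈ S' ∨ φ s = 1) (g : G) :
    wordLength S' (φ g) ≤ wordLength S g := by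
  refine le_wordLength (f := fun g => wordLength S' (φ g)) hS (by simp [wordLength_one])
    (fun s g hs => ?_) g
  simp only [map_mul]
  refine (wordLength_mul_le hS' _ _).trans ?_
  rw [add_comm]
  gcongr
  have key : ∀ s ∈ S, wordLength S' (φ s) ≤ 1 := fun s hs => by
    rcases hφ s hs with h | h
    · exact wordLength_le_one (Or.inl h)
    · simp [h, wordLength_one]
  rcases hs with hs | hs
  · exact key s hs
  · rw [← wordLength_inv hS', ← map_inv]
    exact key _ hs

lemma finite_setOf_wordLength_le (hS : Subgroup.closure S = ⊤) (hfin : S.Finite) (m : ℕ) :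
    {g : G | wordLength S g ≤ m}.Finite := by
  have hfin' : {x : G | x ∈ S ∨ x⁻¹ ∈ S}.Finite := by
    have : {x : G | x ∈ S ∨ x⁻¹ ∈ S} = S ∪ S⁻¹ := by ext; simp
    rw [this]
    exact hfin.union hfin.inv
  have : Finite {x : G // x ∈ S ∨ x⁻¹ ∈ S} := hfin'
  refine ((List.finite_length_le {x : G // x ∈ S ∨ x⁻¹ ∈ S} m).image
    fun l => (l.map Subtype.val).prod).subset fun g hg => ?_
  obtain ⟨l, hl, hlS, hp⟩ := exists_list_length_eq_wordLength hS g
  refine ⟨l.attachWith _ hlS, ?_, ?_⟩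
  · simpa [hl] using hg
  · simpa using hp

end WordLength

section Colorings

variable {Y : Type*}

/-- A coloring `κ` is `M`-bounded at scale `s` if any two points joined by a monochromatic
`s`-chain are at distance at most `M`. -/
def BoundedColoring {n : ℕ} (d : Y → Y → ℝ) (s M : ℝ) (κ : Y → Fin (n + 1)) : Prop :=
  ∀ x y, Relation.ReflTransGen (fun a b => κ a = κ b ∧ d a b < s) x y → d x y ≤ M

lemma isDChain_iff_reflTransGen {d : Y → Y → ℝ} {s : ℝ} {U : Set Y} {x y : Y} :
    IsDChain d s U x y ↔
      x ∈ U ∧ Relation.ReflTransGen (fun a b => (a ∈ U ∧ b ∈ U) ∧ d a b < s) x y := by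
  constructor
  · rintro ⟨m, c, rfl, rfl, hU, hd⟩
    refine ⟨hU 0 (Nat.zero_le _), ?_⟩
    induction m with
    | zero => exact .refl
    | succ m ih =>
      exact (ih (fun i hi => hU i (by omega)) fun i hi => hd i (by omega)).tail
        ⟨⟨hU _ (by omega), hU _ le_rfl⟩, hd m (by omega)⟩
  · rintro ⟨hx, h⟩
    induction h with
    | refl => exact ⟨0, fun _ => x, rfl, rfl, fun _ _ => hx, by simp⟩
    | @tail b z _ hz ih =>
      obtain ⟨m, c, h0, hm, hU, hd⟩ := ih
      refine ⟨m + 1, fun i => if i ≤ m then c i else z, by simpa using h0, by simp, ?_, ?_⟩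
      · intro i hi
        by_cases him : i ≤ m
        · simpa [him] using hU i him
        · simpa [him] using hz.1.2
      · intro i hi
        have him : i ≤ m := by omega
        by_cases him' : i + 1 ≤ m
        · simpa [him, him'] using hd i (by omega)
        · obtain rfl : i = m := by omega
          simpa [hm] using hz.2

lemma isDComponent_setOf_isDChain {d : Y → Y → ℝ} (hd : ∀ x y, d x y = d y x) {s : ℝ}
    {U : Set Y} {x : Y} (hx : x ∈ U) : IsDComponent d s U {y | IsDChain d s U x y} := by
  have hsub : ∀ y, IsDChain d s U x y → y ∈ U := fun y ⟨m, c, _, hm, hU, _⟩ =>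
    hm ▸ hU m le_rfl
  have : Std.Symm (fun a b => (a ∈ U ∧ b ∈ U) ∧ d a b < s) :=
    ⟨fun a b h => ⟨h.1.symm, by rw [hd]; exact h.2⟩⟩
  refine ⟨hsub, fun y hy z hz => ?_, fun C hC hCU hconn => hC.antisymm fun y hy => ?_⟩
  · have hy' := isDChain_iff_reflTransGen.1 hy
    have hz' := isDChain_iff_reflTransGen.1 hz
    refine isDChain_iff_reflTransGen.2 ⟨hy, ?_⟩
    have hyz := (Relation.ReflTransGen.stdSymm.symm _ _ hy'.2).trans hz'.2
    clear hz hz'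
    induction hyz with
    | refl => exact .refl
    | @tail b c hb hbc ih =>
      have hb' : IsDChain d s U x b := isDChain_iff_reflTransGen.2 ⟨hx, hy'.2.trans hb⟩
      exact ih.tail ⟨⟨hb', isDChain_iff_reflTransGen.2 ⟨hx, (hy'.2.trans hb).tail hbc⟩⟩, hbc.2⟩
  · have hxC : x ∈ C := hC (isDChain_iff_reflTransGen.2 ⟨hx, .refl⟩)
    obtain ⟨m, c, h0, hm, hU, hd⟩ := hconn x hxC y hy
    exact ⟨m, c, h0, hm, fun i hi => hCU (hU i hi), hd⟩

lemma dimLeAtScale_iff_exists_boundedColoring {d : Y → Y → ℝ} (hd : ∀ x y, d x y = d y x)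
    {n : ℕ} {s M : ℝ} :
    DimLeAtScale d n s M ↔ ∃ κ : Y → Fin (n + 1), BoundedColoring d s M κ := by
  constructor
  · rintro ⟨U, hU, hb⟩
    choose κ hκ using hU
    refine ⟨κ, fun x y hxy => ?_⟩
    have hchain : Relation.ReflTransGen
        (fun a b => (a ∈ U (κ x) ∧ b ∈ U (κ x)) ∧ d a b < s) x y ∧ κ y = κ x := by
      induction hxy with
      | refl => exact ⟨.refl, rfl⟩
      | @tail b c _ hbc ih =>
        refine ⟨ih.1.tail ⟨⟨ih.2 ▸ hκ b, ?_⟩, hbc.2⟩, hbc.1.symm.trans ih.2⟩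
        exact (hbc.1.symm.trans ih.2) ▸ hκ c
    exact hb _ _ (isDComponent_setOf_isDChain hd (hκ x))
      x (isDChain_iff_reflTransGen.2 ⟨hκ x, .refl⟩)
      y (isDChain_iff_reflTransGen.2 ⟨hκ x, hchain.1⟩)
  · rintro ⟨κ, hκ⟩
    refine ⟨fun i => κ ⁻¹' {i}, fun y => ⟨κ y, rfl⟩, fun i C hC x hx y hy => hκ x y ?_⟩
    refine (isDChain_iff_reflTransGen.1 (hC.2.1 x hx y hy)).2.lift id fun a b h => ⟨?_, h.2⟩
    exact (hC.1 h.1.1 : κ a = i).trans (hC.1 h.1.2 : κ b = i).symm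

lemma BoundedColoring.comp {Z : Type*} {n : ℕ} {d : Y → Y → ℝ} {d' : Z → Z → ℝ} {s M : ℝ}
    {κ : Y → Fin (n + 1)} (hκ : BoundedColoring d s M κ) (φ : Z → Y)
    (hφ : ∀ a b, d (φ a) (φ b) = d' a b) : BoundedColoring d' s M (κ ∘ φ) := fun x y hxy => by
  rw [← hφ]
  exact hκ _ _ (hxy.lift φ fun a b h => ⟨h.1, by rw [hφ]; exact h.2⟩)

end Colorings

section ANdimBasic

lemma wordDist_comm {G : Type*} [Group G] {S : Set G} (hS : Subgroup.closure S = ⊤) (g h : G) :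
    wordDist S g h = wordDist S h g := by
  rw [wordDist, wordDist, ← wordLength_inv hS, mul_inv_rev, inv_inv]

lemma ANdimLe.of_isometry {Y Z : Type*} {d : Y → Y → ℝ} {d' : Z → Z → ℝ} {n : ℕ}
    (hd : ∀ x y, d x y = d y x) (hd' : ∀ x y, d' x y = d' y x) (φ : Z → Y)
    (hφ : ∀ a b, d (φ a) (φ b) = d' a b) (h : ANdimLe d n) : ANdimLe d' n := by
  obtain ⟨C, b, hC, hb, hf⟩ := h
  refine ⟨C, b, hC, hb, fun s hs => ?_⟩
  obtain ⟨κ, hκ⟩ := (dimLeAtScale_iff_exists_boundedColoring hd).1 (hf s hs)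
  exact (dimLeAtScale_iff_exists_boundedColoring hd').2 ⟨_, hκ.comp φ hφ⟩

lemma DimLeAtScale.mono {Y : Type*} {d : Y → Y → ℝ} (hd : ∀ x y, d x y = d y x) {n k : ℕ}
    {s M : ℝ} (hnk : n ≤ k) (h : DimLeAtScale d n s M) : DimLeAtScale d k s M := by
  rw [dimLeAtScale_iff_exists_boundedColoring hd] at h ⊢
  obtain ⟨κ, hκ⟩ := h
  have hle : n + 1 ≤ k + 1 := by omega
  exact ⟨fun y => Fin.castLE hle (κ y), fun x y hxy => hκ x y
    (hxy.lift id fun a b h => ⟨Fin.castLE_injective hle h.1, h.2⟩)⟩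

lemma ANdimLe.mono {Y : Type*} {d : Y → Y → ℝ} (hd : ∀ x y, d x y = d y x) {n k : ℕ}
    (hnk : n ≤ k) (h : ANdimLe d n) : ANdimLe d k := by
  obtain ⟨C, b, hC, hb, hf⟩ := h
  exact ⟨C, b, hC, hb, fun s hs => (hf s hs).mono hd hnk⟩

lemma asdimAN_le_iff {Y : Type*} {d : Y → Y → ℝ} (hd : ∀ x y, d x y = d y x) {n : ℕ} :
    asdimAN d ≤ n ↔ ANdimLe d n := by
  refine ⟨fun h => ?_, fun h => sInf_le ⟨n, rfl, h⟩⟩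
  have hne : {N : ℕ∞ | ∃ n : ℕ, N = (n : ℕ∞) ∧ ANdimLe d n}.Nonempty := by
    by_contra hne
    rw [Set.not_nonempty_iff_eq_empty] at hne
    rw [asdimAN, hne, sInf_empty] at h
    exact absurd h (by simp)
  obtain ⟨k, hk, hk'⟩ := csInf_mem hne
  rw [asdimAN, hk, Nat.cast_le] at h
  exact hk'.mono hd h

lemma not_aNdimLe_zero {G : Type*} [Group G] [Infinite G] {S : Set G} (hfin : S.Finite)
    (hS : Subgroup.closure S = ⊤) : ¬ ANdimLe (wordDist S) 0 := by
  rintro ⟨C, b, -, -, hf⟩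
  obtain ⟨κ, hκ⟩ :=
    (dimLeAtScale_iff_exists_boundedColoring (wordDist_comm hS)).1 (hf 2 two_pos)
  refine Set.infinite_univ ((finite_setOf_wordLength_le hS hfin ⌊C * 2 + b⌋₊).subset ?_)
  intro g _
  refine Nat.le_floor ?_
  suffices h : wordDist S 1 g ≤ C * 2 + b by simpa [wordDist] using h
  refine hκ _ _ ?_
  obtain ⟨l, -, hlS, hl⟩ := exists_list_length_eq_wordLength hS g
  rw [← hl]
  clear hl
  induction l using List.reverseRecOn with
  | nil => exact .refl
  | append_singleton l a ih =>
    refine (ih fun x hx => hlS x (by simp [hx])).tail ⟨Subsingleton.elim (α := Fin 1) _ _, ?_⟩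
    have h1 : wordLength S a ≤ 1 := wordLength_le_one (hlS a (by simp))
    simp only [wordDist, List.prod_append, List.prod_singleton, inv_mul_cancel_left]
    exact_mod_cast Nat.lt_succ_of_le h1

end ANdimBasic

section Anchors

variable {α : Type*} (ℓ : α → ℕ) (R : ℕ)

/-- Total weight of a list of letters. -/
def listWeight (l : List α) : ℕ := (l.map ℓ).sum

@[simp] lemma listWeight_nil : listWeight ℓ [] = 0 := rfl

@[simp] lemma listWeight_cons (a : α) (l : List α) :
    listWeight ℓ (a :: l) = ℓ a + listWeight ℓ l := by simp [listWeight]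

@[simp] lemma listWeight_append (l k : List α) :
    listWeight ℓ (l ++ k) = listWeight ℓ l + listWeight ℓ k := by simp [listWeight]

/-- The anchor of a list is a suffix of it; it stays the same when letters are added on the left
as long as the weight exceeds that of the anchor by at most `R`, and is then reset to the whole
list. -/
def anchor : List α → List α
  | [] => []
  | a :: l => if listWeight ℓ (a :: l) ≤ listWeight ℓ (anchor l) + R then anchor l else a :: l

/-- The coloring of lists induced by a coloring `base` of letters: it is constant on the lists
with a given anchor, anchors at distance in `(R, 2R]` from the previous anchor get the next color,
and the other ones are colored by their first letter. -/
def anchorColor {n : ℕ} (base : α → Fin (n + 1)) : List α → Fin (n + 1)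
  | [] => 0
  | a :: l =>
    if listWeight ℓ (a :: l) ≤ listWeight ℓ (anchor ℓ R l) + R then anchorColor base l
    else if listWeight ℓ (a :: l) ≤ listWeight ℓ (anchor ℓ R l) + 2 * R then anchorColor base l + 1
    else base a

/-- The anchors at distance in `(R, 2R]` from the previous anchor. -/
def IsBuffer : List α → Prop
  | [] => False
  | a :: l => listWeight ℓ (anchor ℓ R l) + R < listWeight ℓ (a :: l) ∧
      listWeight ℓ (a :: l) ≤ listWeight ℓ (anchor ℓ R l) + 2 * R

variable {ℓ R}

lemma exists_append_anchor (l : List α) : ∃ u, u ++ anchor ℓ R l = l := by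
  induction l with
  | nil => exact ⟨[], rfl⟩
  | cons a l ih =>
    rw [anchor]
    split_ifs
    · obtain ⟨u, hu⟩ := ih
      exact ⟨a :: u, by simp [hu]⟩
    · exact ⟨[], rfl⟩

lemma listWeight_le_anchor_add (l : List α) :
    listWeight ℓ l ≤ listWeight ℓ (anchor ℓ R l) + R := by
  cases l with
  | nil => simp
  | cons a l =>
    rw [anchor]
    split_ifs with h
    · exact h
    · exact Nat.le_add_right _ _

lemma anchor_append_of_le {u m : List α}
    (h : listWeight ℓ (u ++ m) ≤ listWeight ℓ (anchor ℓ R m) + R) :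
    anchor ℓ R (u ++ m) = anchor ℓ R m := by
  induction u with
  | nil => rfl
  | cons a u ih =>
    have hu : listWeight ℓ (u ++ m) ≤ listWeight ℓ (anchor ℓ R m) + R := by
      simp only [List.cons_append, listWeight_cons] at h
      omega
    rw [List.cons_append, anchor, ih hu, if_pos (by simpa using h)]

lemma anchor_cons_of_lt {a : α} {l : List α}
    (h : listWeight ℓ (anchor ℓ R l) + R < listWeight ℓ (a :: l)) :
    anchor ℓ R (a :: l) = a :: l := by
  rw [anchor, if_neg (by omega)]

lemma lt_of_anchor_eq_cons {a : α} {l x : List α} (h : anchor ℓ R x = a :: l) :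
    listWeight ℓ (anchor ℓ R l) + R < listWeight ℓ (a :: l) := by
  induction x with
  | nil => simp [anchor] at h
  | cons b x ih =>
    rw [anchor] at h
    split_ifs at h with hx
    · exact ih h
    · obtain ⟨rfl, rfl⟩ := List.cons.inj h
      omega

section Color

variable {n : ℕ} {base : α → Fin (n + 1)}

lemma anchorColor_anchor (l : List α) :
    anchorColor ℓ R base (anchor ℓ R l) = anchorColor ℓ R base l := by
  induction l with
  | nil => rfl
  | cons a l ih =>
    rw [anchor]
    split_ifs with h
    · rw [ih, anchorColor, if_pos h]
    · rfl

lemma IsBuffer.anchorColor_eq {x : List α} (h : IsBuffer ℓ R x) :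
    anchorColor ℓ R base x = anchorColor ℓ R base x.tail + 1 := by
  cases x with
  | nil => exact h.elim
  | cons a l => rw [anchorColor, if_neg (by have := h.1; omega), if_pos h.2, List.tail_cons]

lemma anchorColor_of_not_isBuffer {a : α} {l x : List α} (hx : anchor ℓ R x = a :: l)
    (h : ¬ IsBuffer ℓ R (a :: l)) : anchorColor ℓ R base x = base a := by
  have h1 := lt_of_anchor_eq_cons hx
  rw [← anchorColor_anchor, hx, anchorColor, if_neg (by omega),
    if_neg fun h2 => h ⟨h1, h2⟩]

end Color

/-- The anchor of `x` is `q` or a buffer whose previous anchor is `q`. -/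
def NearAnchor (ℓ : α → ℕ) (R : ℕ) (q x : List α) : Prop :=
  anchor ℓ R x = q ∨ IsBuffer ℓ R (anchor ℓ R x) ∧ anchor ℓ R (anchor ℓ R x).tail = q

lemma nearAnchor_append {u m : List α} (hu : listWeight ℓ u < R) :
    NearAnchor ℓ R (anchor ℓ R m) (u ++ m) := by
  have hm := listWeight_le_anchor_add (ℓ := ℓ) (R := R) m
  induction u with
  | nil => exact Or.inl rfl
  | cons a u ih =>
    rw [listWeight_cons] at hu
    rw [NearAnchor, List.cons_append, anchor]
    split_ifs with h
    · exact ih (by omega)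
    rcases ih (by omega) with hq | ⟨hb, hq⟩
    · right
      refine ⟨⟨by omega, ?_⟩, hq⟩
      rw [hq, listWeight_cons, listWeight_append]
      omega
    · exfalso
      cases hx : anchor ℓ R (u ++ m) with
      | nil => rw [hx] at hb; exact hb
      | cons b k =>
        rw [hx] at hb hq
        rw [List.tail_cons] at hq
        have := hb.1
        rw [hq] at this
        rw [hx] at h
        rw [listWeight_cons ℓ a, listWeight_append] at h
        omega

lemma nearAnchor_or_anchor_eq {u m : List α} {a : α} (hu : listWeight ℓ u < R) :
    (NearAnchor ℓ R (anchor ℓ R m) (u ++ a :: m) ∧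
      listWeight ℓ (a :: m) ≤ listWeight ℓ (anchor ℓ R m) + R) ∨
    anchor ℓ R (u ++ a :: m) = a :: m := by
  by_cases h : listWeight ℓ (a :: m) ≤ listWeight ℓ (anchor ℓ R m) + R
  · have ha : anchor ℓ R (a :: m) = anchor ℓ R m := by rw [anchor, if_pos h]
    exact Or.inl ⟨ha ▸ nearAnchor_append hu, h⟩
  · have ha : anchor ℓ R (a :: m) = a :: m := anchor_cons_of_lt (by omega)
    right
    rw [anchor_append_of_le, ha]
    rw [ha, listWeight_append]
    omega

/-- Anchors which coincide or are both buffers with the same previous anchor. -/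
def AnchorsLinked (ℓ : α → ℕ) (R : ℕ) (x y : List α) : Prop :=
  x = y ∨ IsBuffer ℓ R x ∧ IsBuffer ℓ R y ∧ anchor ℓ R x.tail = anchor ℓ R y.tail

lemma NearAnchor.anchorsLinked {n : ℕ} (hn : n ≠ 0) {base : α → Fin (n + 1)} {q x y : List α}
    (hx : NearAnchor ℓ R q x) (hy : NearAnchor ℓ R q y)
    (hc : anchorColor ℓ R base x = anchorColor ℓ R base y) :
    AnchorsLinked ℓ R (anchor ℓ R x) (anchor ℓ R y) := by
  have hne (i : Fin (n + 1)) : i ≠ i + 1 := by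
    obtain ⟨k, rfl⟩ := Nat.exists_eq_succ_of_ne_zero hn
    simp
  have hbuf (z : List α) (hb : IsBuffer ℓ R (anchor ℓ R z))
      (hq : anchor ℓ R (anchor ℓ R z).tail = q) :
      anchorColor ℓ R base z = anchorColor ℓ R base q + 1 := by
    rw [← anchorColor_anchor, hb.anchorColor_eq, ← hq, anchorColor_anchor]
  rcases hx with hx | ⟨hxb, hxq⟩ <;> rcases hy with hy | ⟨hyb, hyq⟩
  · exact Or.inl (hx.trans hy.symm)
  · rw [hbuf y hyb hyq, ← anchorColor_anchor, hx] at hc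
    exact (hne _ hc).elim
  · rw [hbuf x hxb hxq, ← anchorColor_anchor y, hy] at hc
    exact (hne _ hc.symm).elim
  · exact Or.inr ⟨hxb, hyb, hxq.trans hyq.symm⟩

end Anchors

section FreeProduct

open Monoid

variable {ι : Type*} {M : ι → Type*} [∀ i, Group (M i)] {A : ∀ i, Set (M i)}

/-- The generating set of a free product given by generating sets of the factors. -/
def coprodGens (A : ∀ i, Set (M i)) : Set (CoprodI M) :=
  ⋃ i, (⇑(CoprodI.of : M i →* CoprodI M)) '' A i

lemma closure_coprodGens (hA : ∀ i, Subgroup.closure (A i) = ⊤) :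
    Subgroup.closure (coprodGens A) = ⊤ := by
  refine (Subgroup.eq_top_iff' _).2 fun x => ?_
  induction x using CoprodI.induction_on with
  | one => exact one_mem _
  | mul x y hx hy => exact mul_mem hx hy
  | of i m =>
    have hm : CoprodI.of m ∈ (Subgroup.closure (A i)).map (CoprodI.of : M i →* CoprodI M) :=
      ⟨m, by simp [hA], rfl⟩
    rw [MonoidHom.map_closure] at hm
    exact Subgroup.closure_mono (Set.subset_iUnion_of_subset i subset_rfl) hm

/-- The word length of a letter in its factor. -/
noncomputable def letterLength (A : ∀ i, Set (M i)) (a : Σ i, M i) : ℕ := wordLength (A a.1) a.2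

/-- The element of the free product represented by a list of letters. -/
def lettersProd (l : List (Σ i, M i)) : CoprodI M := (l.map fun a => CoprodI.of a.2).prod

lemma lettersProd_cons (a : Σ i, M i) (l : List (Σ i, M i)) :
    lettersProd (a :: l) = CoprodI.of a.2 * lettersProd l := by simp [lettersProd]

lemma lettersProd_append (l k : List (Σ i, M i)) :
    lettersProd (l ++ k) = lettersProd l * lettersProd k := by simp [lettersProd]

/-- A list of nontrivial letters whose consecutive letters lie in different factors. -/
def IsReducedList (l : List (Σ i, M i)) : Prop :=
  (∀ a ∈ l, a.2 ≠ 1) ∧ l.IsChain fun a b => a.1 ≠ b.1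

lemma wordLength_of_le (hA : ∀ i, Subgroup.closure (A i) = ⊤) {i : ι} (m : M i) :
    wordLength (coprodGens A) (CoprodI.of m) ≤ wordLength (A i) m :=
  wordLength_map_le (hA i) (closure_coprodGens hA) CoprodI.of
    (fun s hs => Or.inl (Set.mem_iUnion_of_mem i ⟨s, hs, rfl⟩)) m

lemma wordLength_lettersProd_le (hA : ∀ i, Subgroup.closure (A i) = ⊤) (l : List (Σ i, M i)) :
    wordLength (coprodGens A) (lettersProd l) ≤ listWeight (letterLength A) l := by
  induction l with
  | nil => exact wordLength_one.le
  | cons a l ih =>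
    rw [lettersProd_cons, listWeight_cons]
    exact (wordLength_mul_le (closure_coprodGens hA) _ _).trans
      (add_le_add (wordLength_of_le hA a.2) ih)

open Classical in
lemma wordLength_lettersProd (hA : ∀ i, Subgroup.closure (A i) = ⊤) {l : List (Σ i, M i)}
    (hl : IsReducedList l) :
    wordLength (coprodGens A) (lettersProd l) = listWeight (letterLength A) l := by
  refine (wordLength_lettersProd_le hA l).antisymm ?_
  have hrcons {i : ι} (p : CoprodI.Word.Pair M i) :
      listWeight (letterLength A) (CoprodI.Word.rcons p).toList =
        wordLength (A i) p.head + listWeight (letterLength A) p.tail.toList := by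
    rw [CoprodI.Word.rcons]
    split_ifs with h
    · simp [h, wordLength_one]
    · simp [letterLength]
  have hsmul {i : ι} (m : M i) (w : CoprodI.Word M) :
      listWeight (letterLength A) (CoprodI.of m • w).toList ≤
        listWeight (letterLength A) w.toList + wordLength (A i) m := by
    have hw : listWeight (letterLength A) w.toList =
        listWeight (letterLength A)
          (CoprodI.Word.rcons (CoprodI.Word.equivPair i w)).toList := by
      rw [← CoprodI.Word.equivPair_symm, Equiv.symm_apply_apply]
    rw [CoprodI.Word.of_smul_def, hw, hrcons, hrcons]
    have := wordLength_mul_le (hA i) m (CoprodI.Word.equivPair i w).head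
    dsimp only
    omega
  let w : CoprodI.Word M := ⟨l, hl.1, hl.2⟩
  have hw : CoprodI.Word.equiv (lettersProd l) = w := CoprodI.Word.equiv.right_inv w
  change listWeight (letterLength A) w.toList ≤ _
  rw [← hw]
  refine le_wordLength (f := fun x => listWeight (letterLength A) (CoprodI.Word.equiv x).toList)
    (closure_coprodGens hA) ?_ (fun s g hs => ?_) _
  · change listWeight (letterLength A) ((1 : CoprodI M) • CoprodI.Word.empty).toList = 0
    rw [one_smul]
    rfl
  · change listWeight (letterLength A) ((s * g) • CoprodI.Word.empty).toList ≤
      listWeight (letterLength A) (g • CoprodI.Word.empty).toList + 1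
    obtain ⟨i, m, hm, rfl⟩ : ∃ (i : ι) (m : M i), (m ∈ A i ∨ m⁻¹ ∈ A i) ∧ CoprodI.of m = s := by
      rcases hs with hs | hs <;> obtain ⟨i, m, hm, hms⟩ := Set.mem_iUnion.1 hs
      · exact ⟨i, m, Or.inl hm, hms⟩
      · exact ⟨i, m⁻¹, Or.inr (by simpa using hm), by rw [map_inv, hms, inv_inv]⟩
    rw [mul_smul]
    exact (hsmul m _).trans (by gcongr; exact wordLength_le_one hm)

lemma exists_isReducedList (g : CoprodI M) : ∃ l, IsReducedList l ∧ lettersProd l = g := by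
  classical
  exact ⟨(CoprodI.Word.equiv g).toList, ⟨(CoprodI.Word.equiv g).ne_one,
    (CoprodI.Word.equiv g).chain_ne⟩, CoprodI.Word.equiv.left_inv g⟩

/-- The list of inverses in reversed order. -/
def invRev (l : List (Σ i, M i)) : List (Σ i, M i) :=
  (l.map fun a => ⟨a.1, a.2⁻¹⟩).reverse

lemma invRev_cons (a : Σ i, M i) (l : List (Σ i, M i)) :
    invRev (a :: l) = invRev l ++ [⟨a.1, a.2⁻¹⟩] := by simp [invRev]

lemma lettersProd_invRev (l : List (Σ i, M i)) : lettersProd (invRev l) = (lettersProd l)⁻¹ := by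
  induction l with
  | nil => simp [invRev, lettersProd]
  | cons a l ih =>
    rw [invRev_cons, lettersProd_append, ih, lettersProd_cons a, mul_inv_rev]
    simp [lettersProd]

lemma listWeight_invRev (hA : ∀ i, Subgroup.closure (A i) = ⊤) (l : List (Σ i, M i)) :
    listWeight (letterLength A) (invRev l) = listWeight (letterLength A) l := by
  induction l with
  | nil => rfl
  | cons a l ih =>
    rw [invRev_cons, listWeight_append, ih, listWeight_cons, listWeight_cons]
    simp [letterLength, wordLength_inv (hA a.1), add_comm]

lemma IsReducedList.invRev {l : List (Σ i, M i)} (hl : IsReducedList l) :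
    IsReducedList (invRev l) := by
  refine ⟨fun a ha => ?_, ?_⟩
  · obtain ⟨b, hb, rfl⟩ : ∃ b ∈ l, (⟨b.1, b.2⁻¹⟩ : Σ i, M i) = a := by
      simpa only [_root_.invRev, List.mem_reverse, List.mem_map] using ha
    simpa using hl.1 b hb
  · rw [_root_.invRev, List.isChain_reverse, List.isChain_map]
    exact hl.2.imp fun a b h => h.symm

lemma IsReducedList.left {u v : List (Σ i, M i)} (h : IsReducedList (u ++ v)) :
    IsReducedList u :=
  ⟨fun a ha => h.1 a (by simp [ha]), (List.isChain_append.1 h.2).1⟩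

lemma IsReducedList.right {u v : List (Σ i, M i)} (h : IsReducedList (u ++ v)) :
    IsReducedList v :=
  ⟨fun a ha => h.1 a (by simp [ha]), (List.isChain_append.1 h.2).2.1⟩

lemma IsReducedList.append_cons {u v : List (Σ i, M i)} {a b c : Σ i, M i}
    (hu : IsReducedList (u ++ [a])) (hv : IsReducedList (b :: v)) (ha : a.1 = c.1)
    (hb : b.1 = c.1) (hc : c.2 ≠ 1) : IsReducedList (u ++ c :: v) := by
  refine ⟨?_, ?_⟩
  · intro x hx
    rcases List.mem_append.1 hx with hx | hx
    · exact hu.1 x (by simp [hx])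
    rcases List.mem_cons.1 hx with rfl | hx
    · exact hc
    · exact hv.1 x (by simp [hx])
  · have h1 := List.isChain_append.1 hu.2
    have h2 := List.isChain_cons.1 hv.2
    refine List.isChain_append.2 ⟨h1.1, List.isChain_cons.2 ⟨fun y hy => hb ▸ h2.1 y hy, h2.2⟩,
      fun x hx y hy => ?_⟩
    have := h1.2.2 x hx a (by simp)
    simp only [List.head?_cons, Option.mem_def, Option.some.injEq] at hy
    rw [← hy, ← ha]
    exact this

/-- The distance between elements of the free product given by lists of letters, with respect to
the right invariant word metric. -/
noncomputable def listDist (A : ∀ i, Set (M i)) (x y : List (Σ i, M i)) : ℕ :=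
  wordLength (coprodGens A) (lettersProd x * (lettersProd y)⁻¹)

lemma listDist_comm (hA : ∀ i, Subgroup.closure (A i) = ⊤) (x y : List (Σ i, M i)) :
    listDist A x y = listDist A y x := by
  rw [listDist, ← wordLength_inv (closure_coprodGens hA), mul_inv_rev, inv_inv, listDist]

lemma listDist_triangle (hA : ∀ i, Subgroup.closure (A i) = ⊤) (x y z : List (Σ i, M i)) :
    listDist A x z ≤ listDist A x y + listDist A y z := by
  refine le_trans (le_of_eq ?_) (wordLength_mul_le (closure_coprodGens hA) _ _)
  rw [listDist]
  group

lemma listDist_append_le (hA : ∀ i, Subgroup.closure (A i) = ⊤) (u m : List (Σ i, M i)) :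
    listDist A (u ++ m) m ≤ listWeight (letterLength A) u := by
  rw [listDist, lettersProd_append, mul_inv_cancel_right]
  exact wordLength_lettersProd_le hA u

lemma listDist_cons_cons_le (hA : ∀ i, Subgroup.closure (A i) = ⊤) {i : ι} (a b : M i)
    (m : List (Σ i, M i)) : listDist A (⟨i, a⟩ :: m) (⟨i, b⟩ :: m) ≤ wordLength (A i) (a * b⁻¹) := by
  rw [listDist, lettersProd_cons, lettersProd_cons, mul_inv_rev, ← mul_assoc,
    mul_inv_cancel_right, ← map_inv, ← map_mul]
  exact wordLength_of_le hA _

lemma listDist_append_right (u v m : List (Σ i, M i)) :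
    listDist A (u ++ m) (v ++ m) = listDist A u v := by
  simp [listDist, lettersProd_append, mul_assoc]

lemma listDist_append_append (u v : List (Σ i, M i)) {i : ι} (a b : M i) :
    listDist A (u ++ [⟨i, a⟩]) (v ++ [⟨i, b⟩]) =
      wordLength (coprodGens A) (lettersProd (u ++ ⟨i, a * b⁻¹⟩ :: invRev v)) := by
  simp [listDist, lettersProd_append, lettersProd_cons, lettersProd_invRev, mul_assoc]

lemma listDist_eq_of_isReducedList (hA : ∀ i, Subgroup.closure (A i) = ⊤)
    {u v : List (Σ i, M i)} (h : IsReducedList (u ++ invRev v)) :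
    listDist A u v =
      listWeight (letterLength A) u + listWeight (letterLength A) v := by
  rw [listDist, ← lettersProd_invRev, ← lettersProd_append, wordLength_lettersProd hA h,
    listWeight_append, listWeight_invRev hA]

lemma exists_common_suffix {α : Type*} (x y : List α) :
    ∃ m u v, x = u ++ m ∧ y = v ++ m ∧ ∀ a ∈ u.getLast?, ∀ b ∈ v.getLast?, a ≠ b := by
  induction x using List.reverseRecOn generalizing y with
  | nil => exact ⟨[], [], y, by simp⟩
  | append_singleton x a ih =>
    induction y using List.reverseRecOn with
    | nil => exact ⟨[], x ++ [a], [], by simp⟩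
    | append_singleton y b _ =>
      by_cases hab : a = b
      · obtain ⟨m, u, v, rfl, rfl, h⟩ := ih y
        exact ⟨m ++ [a], u, v, by simp, by simp [hab], h⟩
      · exact ⟨[], x ++ [a], y ++ [b], by simpa using hab⟩

lemma exists_branching (hA : ∀ i, Subgroup.closure (A i) = ⊤) {x y : List (Σ i, M i)}
    (hx : IsReducedList x) (hy : IsReducedList y) :
    (∃ m u v, x = u ++ m ∧ y = v ++ m ∧ listWeight (letterLength A) u ≤ listDist A x y ∧
      listWeight (letterLength A) v ≤ listDist A x y) ∨
    ∃ m u v, ∃ (i : ι) (a b : M i), x = u ++ ⟨i, a⟩ :: m ∧ y = v ++ ⟨i, b⟩ :: m ∧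
      listWeight (letterLength A) u ≤ listDist A x y ∧
      listWeight (letterLength A) v ≤ listDist A x y ∧
      wordLength (A i) (a * b⁻¹) ≤ listDist A x y := by
  obtain ⟨m, u, v, rfl, rfl, h⟩ := exists_common_suffix x y
  rw [listDist_append_right]
  by_cases hidx : ∀ a ∈ u.getLast?, ∀ b ∈ v.getLast?, a.1 ≠ b.1
  · left
    refine ⟨m, u, v, rfl, rfl, ?_⟩
    rw [listDist_eq_of_isReducedList hA]
    · omega
    have hv := hy.left.invRev
    refine ⟨fun a ha => ?_, List.isChain_append.2 ⟨hx.left.2, hv.2, fun a ha b hb => ?_⟩⟩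
    · rcases List.mem_append.1 ha with ha | ha
      exacts [hx.left.1 a ha, hv.1 a ha]
    · obtain ⟨c, hc, rfl⟩ : ∃ c, v.getLast? = some c ∧ (⟨c.1, c.2⁻¹⟩ : Σ i, M i) = b := by
        simpa [invRev, List.head?_reverse] using hb
      exact hidx a ha c hc
  · right
    push Not at hidx
    obtain ⟨⟨i, a⟩, ha, ⟨j, b⟩, hb, hij⟩ := hidx
    obtain rfl : i = j := hij
    obtain ⟨u', rfl⟩ := List.getLast?_eq_some_iff.1 ha
    obtain ⟨v', rfl⟩ := List.getLast?_eq_some_iff.1 hb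
    refine ⟨m, u', v', i, a, b, by simp, by simp, ?_⟩
    have hab : a * b⁻¹ ≠ 1 := fun h' => by
      obtain rfl : a = b := mul_inv_eq_one.1 h'
      exact h _ ha _ hb rfl
    have hv := hy.left.invRev
    rw [invRev, List.map_append, List.reverse_append] at hv
    have hred : IsReducedList (u' ++ ⟨i, a * b⁻¹⟩ :: invRev v') :=
      hx.left.append_cons hv rfl rfl hab
    rw [listDist_append_append, wordLength_lettersProd hA hred, listWeight_append,
      listWeight_cons, listWeight_invRev hA]
    simp only [letterLength]
    omega

end FreeProduct

section Coloring

open Monoid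

variable {ι : Type*} {M : ι → Type*} [∀ i, Group (M i)] {A : ∀ i, Set (M i)} {n R : ℕ}

/-- Anchors of lists of the same color at distance less than `R`. -/
def AnchorsAdj (A : ∀ i, Set (M i)) (R : ℕ) (x y : List (Σ i, M i)) : Prop :=
  AnchorsLinked (letterLength A) R x y ∨
    ∃ (i : ι) (a b : M i) (m : List (Σ i, M i)), x = ⟨i, a⟩ :: m ∧ y = ⟨i, b⟩ :: m ∧
      wordLength (A i) (a * b⁻¹) < R

lemma wordLength_mul_inv_comm {G : Type*} [Group G] {S : Set G} (hS : Subgroup.closure S = ⊤)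
    (a b : G) : wordLength S (a * b⁻¹) = wordLength S (b * a⁻¹) := by
  rw [← wordLength_inv hS, mul_inv_rev, inv_inv]

lemma wordLength_mul_inv_triangle {G : Type*} [Group G] {S : Set G}
    (hS : Subgroup.closure S = ⊤) (a b c : G) :
    wordLength S (a * c⁻¹) ≤ wordLength S (a * b⁻¹) + wordLength S (b * c⁻¹) := by
  refine le_trans (le_of_eq ?_) (wordLength_mul_le hS _ _)
  group

lemma AnchorsAdj.symm (hA : ∀ i, Subgroup.closure (A i) = ⊤) {x y : List (Σ i, M i)}
    (h : AnchorsAdj A R x y) : AnchorsAdj A R y x := by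
  rcases h with (h | ⟨hx, hy, h⟩) | ⟨i, a, b, m, hx, hy, h⟩
  · exact Or.inl (Or.inl h.symm)
  · exact Or.inl (Or.inr ⟨hy, hx, h.symm⟩)
  · exact Or.inr ⟨i, b, a, m, hy, hx, wordLength_mul_inv_comm (hA i) a b ▸ h⟩

lemma anchorsAdj_anchor (hA : ∀ i, Subgroup.closure (A i) = ⊤) (hn : n ≠ 0)
    {base : (Σ i, M i) → Fin (n + 1)} {x y : List (Σ i, M i)} (hx : IsReducedList x)
    (hy : IsReducedList y) (hxy : listDist A x y < R)
    (hc : anchorColor (letterLength A) R base x = anchorColor (letterLength A) R base y) :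
    AnchorsAdj A R (anchor (letterLength A) R x) (anchor (letterLength A) R y) := by
  have hnear {u m : List (Σ i, M i)} {i : ι} {a b : M i}
      (ha : listWeight (letterLength A) (⟨i, a⟩ :: m) ≤
        listWeight (letterLength A) (anchor (letterLength A) R m) + R)
      (hb : anchor (letterLength A) R (u ++ ⟨i, b⟩ :: m) = ⟨i, b⟩ :: m)
      (hab : wordLength (A i) (b * a⁻¹) < R) :
      NearAnchor (letterLength A) R (anchor (letterLength A) R m) (u ++ ⟨i, b⟩ :: m) := by
    refine Or.inr ?_
    rw [hb]
    refine ⟨⟨lt_of_anchor_eq_cons hb, ?_⟩, rfl⟩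
    have := wordLength_mul_le (hA i) (b * a⁻¹) a
    rw [inv_mul_cancel_right] at this
    simp only [listWeight_cons, letterLength] at ha ⊢
    omega
  rcases exists_branching hA hx hy with
    ⟨m, u, v, rfl, rfl, hu, hv⟩ | ⟨m, u, v, i, a, b, rfl, rfl, hu, hv, hab⟩
  · exact Or.inl (NearAnchor.anchorsLinked hn (nearAnchor_append (hu.trans_lt hxy))
      (nearAnchor_append (hv.trans_lt hxy)) hc)
  · have hab' := hab.trans_lt hxy
    rcases nearAnchor_or_anchor_eq (m := m) (a := ⟨i, a⟩) (hu.trans_lt hxy) with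
      ⟨hx1, hx2⟩ | hx1 <;>
    rcases nearAnchor_or_anchor_eq (m := m) (a := ⟨i, b⟩) (hv.trans_lt hxy) with
      ⟨hy1, hy2⟩ | hy1
    · exact Or.inl (hx1.anchorsLinked hn hy1 hc)
    · exact Or.inl (hx1.anchorsLinked hn
        (hnear hx2 hy1 (wordLength_mul_inv_comm (hA i) a b ▸ hab')) hc)
    · exact Or.inl ((hnear hy2 hx1 hab').anchorsLinked hn hy1 hc)
    · exact Or.inr ⟨i, a, b, m, hx1, hy1, hab'⟩

/-- Letters from the factor `i` joined by a monochromatic `R`-chain in that factor. -/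
def LettersJoined (A : ∀ i, Set (M i)) (R : ℕ) (base : (Σ i, M i) → Fin (n + 1)) (i : ι) :
    M i → M i → Prop :=
  Relation.ReflTransGen fun a b => base ⟨i, a⟩ = base ⟨i, b⟩ ∧ wordLength (A i) (a * b⁻¹) < R

/-- An anchor which is a buffer, or whose first letter is joined to a letter adjacent to
the first letter of a buffer with the same tail. -/
def NearBuffer (A : ∀ i, Set (M i)) (R : ℕ) (base : (Σ i, M i) → Fin (n + 1))
    (q x : List (Σ i, M i)) : Prop :=
  ∃ (i : ι) (b : M i) (m : List (Σ i, M i)), x = ⟨i, b⟩ :: m ∧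
    anchor (letterLength A) R m = q ∧ (IsBuffer (letterLength A) R x ∨
      ∃ z g : M i, LettersJoined A R base i b z ∧ wordLength (A i) (z * g⁻¹) < R ∧
        IsBuffer (letterLength A) R (⟨i, g⟩ :: m))

lemma IsBuffer.nearBuffer {base : (Σ i, M i) → Fin (n + 1)} {x : List (Σ i, M i)}
    (h : IsBuffer (letterLength A) R x) :
    NearBuffer A R base (anchor (letterLength A) R x.tail) x := by
  cases x with
  | nil => exact h.elim
  | cons a m => exact ⟨a.1, a.2, m, rfl, rfl, Or.inl h⟩

lemma NearBuffer.of_anchorsAdj (hA : ∀ i, Subgroup.closure (A i) = ⊤)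
    {base : (Σ i, M i) → Fin (n + 1)} {q x y : List (Σ i, M i)}
    (hc : anchorColor (letterLength A) R base x = anchorColor (letterLength A) R base y)
    (hadj : AnchorsAdj A R (anchor (letterLength A) R x) (anchor (letterLength A) R y))
    (h : NearBuffer A R base q (anchor (letterLength A) R x)) :
    NearBuffer A R base q (anchor (letterLength A) R y) := by
  rcases hadj with (heq | ⟨-, hyb, hq⟩) | ⟨i, a, b, m, hx, hy, hab⟩
  · exact heq ▸ h
  · obtain ⟨i, b, m, hx, rfl, -⟩ := h
    rw [hx, List.tail_cons] at hq
    exact hq ▸ hyb.nearBuffer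
  · obtain ⟨i', a', m', hx', rfl, hbuf⟩ := h
    rw [hx] at hx' hbuf
    obtain ⟨h1, rfl⟩ := List.cons.inj hx'
    obtain ⟨rfl, h2⟩ := Sigma.mk.inj h1
    obtain rfl := eq_of_heq h2
    refine ⟨i, b, m, hy, rfl, ?_⟩
    rw [hy]
    by_cases hb : IsBuffer (letterLength A) R (⟨i, b⟩ :: m)
    · exact Or.inl hb
    right
    rw [wordLength_mul_inv_comm (hA i)] at hab
    by_cases ha : IsBuffer (letterLength A) R (⟨i, a⟩ :: m)
    · exact ⟨b, a, .refl, hab, ha⟩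
    · obtain ⟨z, g, hz, hzg, hg⟩ := hbuf.resolve_left ha
      refine ⟨z, g, .head ⟨?_, hab⟩ hz, hzg, hg⟩
      rw [← anchorColor_of_not_isBuffer (base := base) hx ha,
        ← anchorColor_of_not_isBuffer (base := base) hy hb, hc]

lemma listDist_le_of_nearBuffer (hA : ∀ i, Subgroup.closure (A i) = ⊤)
    {base : (Σ i, M i) → Fin (n + 1)} {D : ℕ}
    (hD : ∀ i a b, LettersJoined A R base i a b → wordLength (A i) (a * b⁻¹) ≤ D)
    {q x : List (Σ i, M i)} (h : NearBuffer A R base q x) : listDist A x q ≤ D + 3 * R := by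
  have hbuffer (a : Σ i, M i) (m : List (Σ i, M i)) (hb : IsBuffer (letterLength A) R (a :: m)) :
      listDist A (a :: m) (anchor (letterLength A) R m) ≤ 2 * R := by
    obtain ⟨u, hu⟩ := exists_append_anchor (ℓ := letterLength A) (R := R) m
    have h1 := listDist_append_le hA (a :: u) (anchor (letterLength A) R m)
    rw [List.cons_append, hu] at h1
    have h2 := hb.2
    rw [listWeight_cons] at h1 h2
    have h3 := listWeight_append (letterLength A) u (anchor (letterLength A) R m)
    rw [hu] at h3
    omega
  obtain ⟨i, b, m, rfl, rfl, hb | ⟨z, g, hz, hzg, hg⟩⟩ := h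
  · exact (hbuffer _ _ hb).trans (by omega)
  · have h1 := listDist_triangle hA (⟨i, b⟩ :: m) (⟨i, g⟩ :: m) (anchor (letterLength A) R m)
    have h2 := listDist_cons_cons_le hA b g m
    have h3 := wordLength_mul_inv_triangle (hA i) b z g
    have h4 := hD i b z hz
    have h5 := hbuffer _ _ hg
    omega

lemma listDist_anchor_le (hA : ∀ i, Subgroup.closure (A i) = ⊤) (x : List (Σ i, M i)) :
    listDist A x (anchor (letterLength A) R x) ≤ R := by
  obtain ⟨u, hu⟩ := exists_append_anchor (ℓ := letterLength A) (R := R) x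
  have h1 := listDist_append_le hA u (anchor (letterLength A) R x)
  have h2 := listWeight_append (letterLength A) u (anchor (letterLength A) R x)
  have h3 := listWeight_le_anchor_add (ℓ := letterLength A) (R := R) x
  rw [hu] at h1 h2
  omega

lemma listDist_le_of_chain (hA : ∀ i, Subgroup.closure (A i) = ⊤) (hn : n ≠ 0)
    {base : (Σ i, M i) → Fin (n + 1)} {D : ℕ}
    (hD : ∀ i a b, LettersJoined A R base i a b → wordLength (A i) (a * b⁻¹) ≤ D)
    {x y : List (Σ i, M i)}
    (hxy : Relation.ReflTransGen (fun x y => (IsReducedList x ∧ IsReducedList y) ∧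
      anchorColor (letterLength A) R base x = anchorColor (letterLength A) R base y ∧
      listDist A x y < R) x y) : listDist A x y ≤ 2 * D + 8 * R := by
  have hred : listDist A (anchor (letterLength A) R x) (anchor (letterLength A) R y) ≤
      2 * D + 6 * R → listDist A x y ≤ 2 * D + 8 * R := fun h => by
    have h1 := listDist_triangle hA x (anchor (letterLength A) R x) y
    have h2 := listDist_triangle hA (anchor (letterLength A) R x) (anchor (letterLength A) R y) y
    have h3 := listDist_anchor_le (R := R) hA x
    have h4 := listDist_anchor_le (R := R) hA y
    rw [listDist_comm hA] at h4
    omega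
  apply hred
  clear hred
  by_cases hnear : ∃ q, NearBuffer A R base q (anchor (letterLength A) R x)
  · obtain ⟨q, hq⟩ := hnear
    have hq' : NearBuffer A R base q (anchor (letterLength A) R y) := by
      induction hxy with
      | refl => exact hq
      | tail _ hbc ih =>
        exact ih.of_anchorsAdj hA hbc.2.1 (anchorsAdj_anchor hA hn hbc.1.1 hbc.1.2 hbc.2.2 hbc.2.1)
    have h1 := listDist_triangle hA (anchor (letterLength A) R x) q (anchor (letterLength A) R y)
    have h2 := listDist_le_of_nearBuffer hA hD hq
    have h3 := listDist_le_of_nearBuffer hA hD hq'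
    rw [listDist_comm hA] at h3
    omega
  · suffices h : (¬ ∃ q, NearBuffer A R base q (anchor (letterLength A) R y)) ∧
        (anchor (letterLength A) R x = anchor (letterLength A) R y ∨
          ∃ (i : ι) (a b : M i) (m : List (Σ i, M i)),
            anchor (letterLength A) R x = ⟨i, a⟩ :: m ∧
            anchor (letterLength A) R y = ⟨i, b⟩ :: m ∧ LettersJoined A R base i a b) by
      rcases h.2 with h | ⟨i, a, b, m, hx, hy, hab⟩
      · simp [h, listDist, wordLength_one]
      · rw [hx, hy]
        have := (listDist_cons_cons_le hA a b m).trans (hD i a b hab)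
        omega
    induction hxy with
    | refl => exact ⟨hnear, Or.inl rfl⟩
    | @tail y z _ hyz ih =>
      have hadj := anchorsAdj_anchor hA hn hyz.1.1 hyz.1.2 hyz.2.2 hyz.2.1
      have hz : ¬ ∃ q, NearBuffer A R base q (anchor (letterLength A) R z) := fun ⟨q, hq⟩ =>
        ih.1 ⟨q, hq.of_anchorsAdj hA hyz.2.1.symm (hadj.symm hA)⟩
      refine ⟨hz, ?_⟩
      rcases hadj with (heq | ⟨hb, -, -⟩) | ⟨i, a, b, m, hya, hzb, hab⟩
      · exact heq ▸ ih.2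
      · exact (ih.1 ⟨_, hb.nearBuffer⟩).elim
      · have hab' : base ⟨i, a⟩ = base ⟨i, b⟩ ∧ wordLength (A i) (a * b⁻¹) < R := by
          refine ⟨?_, hab⟩
          rw [← anchorColor_of_not_isBuffer (base := base) hya fun h => ih.1 ⟨_, hya ▸ h.nearBuffer⟩,
            ← anchorColor_of_not_isBuffer (base := base) hzb fun h => hz ⟨_, hzb ▸ h.nearBuffer⟩, hyz.2.1]
        right
        rcases ih.2 with hxy | ⟨i', a', b', m', hx, hy, hj⟩
        · exact ⟨i, a, b, m, hxy.trans hya, hzb, .single hab'⟩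
        · rw [hya] at hy
          obtain ⟨h1, rfl⟩ := List.cons.inj hy
          obtain ⟨rfl, h2⟩ := Sigma.mk.inj h1
          obtain rfl := eq_of_heq h2
          exact ⟨i, a', b, m, hx, hzb, hj.tail hab'⟩

lemma exists_boundedColoring_coprodI (hA : ∀ i, Subgroup.closure (A i) = ⊤) (hn : n ≠ 0)
    {D : ℕ} {κ : ∀ i, M i → Fin (n + 1)}
    (hκ : ∀ i, BoundedColoring (wordDist (A i)) R D (κ i)) :
    ∃ κ' : CoprodI M → Fin (n + 1),
      BoundedColoring (wordDist (coprodGens A)) R (2 * D + 8 * R) κ' := by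
  choose w hw hwp using exists_isReducedList (M := M)
  have hdist (g h : CoprodI M) :
      wordDist (coprodGens A) g h = listDist A (w g⁻¹) (w h⁻¹) := by
    rw [wordDist, listDist, hwp, hwp, inv_inv]
  let base : (Σ i, M i) → Fin (n + 1) := fun a => κ a.1 a.2⁻¹
  have hletter (i : ι) (a b : M i) :
      wordDist (A i) a⁻¹ b⁻¹ = wordLength (A i) (a * b⁻¹) := by
    rw [wordDist, inv_inv]
  have hD (i : ι) (a b : M i) (hab : LettersJoined A R base i a b) :
      wordLength (A i) (a * b⁻¹) ≤ D := by
    have h := hκ i a⁻¹ b⁻¹ (hab.lift (·⁻¹) fun a b h => ⟨h.1, by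
      rw [hletter]
      exact_mod_cast h.2⟩)
    rw [hletter] at h
    exact_mod_cast h
  refine ⟨fun g => anchorColor (letterLength A) R base (w g⁻¹), fun g h hgh => ?_⟩
  rw [hdist]
  exact_mod_cast listDist_le_of_chain hA hn hD (hgh.lift (fun g => w g⁻¹) fun g h hgh =>
    ⟨⟨hw _, hw _⟩, hgh.1, by
      have := hgh.2
      rw [hdist] at this
      exact_mod_cast this⟩)

end Coloring

section ANdimCoprod

open Monoid

lemma ANdimLe.coprodI {ι : Type*} [Finite ι] {M : ι → Type*} [∀ i, Group (M i)]
    {A : ∀ i, Set (M i)} {n : ℕ} (hA : ∀ i, Subgroup.closure (A i) = ⊤) (hn : n ≠ 0)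
    (h : ∀ i, ANdimLe (wordDist (A i)) n) : ANdimLe (wordDist (coprodGens A)) n := by
  choose C b _ _ hf using h
  obtain ⟨C', hC'⟩ := Finite.exists_le C
  obtain ⟨b', hb'⟩ := Finite.exists_le b
  obtain ⟨C₀, hC₀, hC⟩ : ∃ C₀ : ℝ, 0 < C₀ ∧ ∀ i, C i ≤ C₀ :=
    ⟨max C' 1, by positivity, fun i => (hC' i).trans (le_max_left _ _)⟩
  obtain ⟨b₀, hb₀, hb⟩ : ∃ b₀ : ℝ, 0 < b₀ ∧ ∀ i, b i ≤ b₀ :=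
    ⟨max b' 1, by positivity, fun i => (hb' i).trans (le_max_left _ _)⟩
  refine ⟨2 * C₀ + 8, 2 * C₀ + 2 * b₀ + 8, by positivity, by positivity, fun s hs => ?_⟩
  have hR : 0 < (⌈s⌉₊ : ℝ) := by exact_mod_cast Nat.ceil_pos.2 hs
  choose κ hκ using fun i =>
    (dimLeAtScale_iff_exists_boundedColoring (wordDist_comm (hA i))).1 (hf i ⌈s⌉₊ hR)
  have hκ' (i : ι) :
      BoundedColoring (wordDist (A i)) ⌈s⌉₊ (⌊C₀ * ⌈s⌉₊ + b₀⌋₊ : ℕ) (κ i) := fun x y hxy => by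
    refine Nat.cast_le.2 (Nat.le_floor ((hκ i x y hxy).trans ?_))
    exact add_le_add (mul_le_mul_of_nonneg_right (hC i) hR.le) (hb i)
  obtain ⟨κ', hκ'⟩ := exists_boundedColoring_coprodI hA hn hκ'
  refine (dimLeAtScale_iff_exists_boundedColoring
    (wordDist_comm (closure_coprodGens hA))).2 ⟨κ', fun x y hxy => ?_⟩
  refine (hκ' x y (hxy.lift id fun a b h => ⟨h.1, h.2.trans_le (Nat.le_ceil s)⟩)).trans ?_
  have h1 : (⌊C₀ * ⌈s⌉₊ + b₀⌋₊ : ℝ) ≤ C₀ * ⌈s⌉₊ + b₀ := Nat.floor_le (by positivity)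
  have h2 : (⌈s⌉₊ : ℝ) ≤ s + 1 := (Nat.ceil_lt_add_one hs.le).le
  have h3 : C₀ * ⌈s⌉₊ ≤ C₀ * (s + 1) := by gcongr
  linarith

/-- A homomorphism sending generators to generators or `1`, with a left inverse of the same
kind, is isometric for the word metrics. -/
lemma wordDist_map {G G' : Type*} [Group G] [Group G'] {S : Set G} {S' : Set G'}
    (hS : Subgroup.closure S = ⊤) (hS' : Subgroup.closure S' = ⊤) (φ : G →* G') (ψ : G' →* G)
    (hφ : ∀ s ∈ S, φ s ∈ S' ∨ φ s = 1) (hψ : ∀ s ∈ S', ψ s ∈ S ∨ ψ s = 1)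
    (hψφ : ∀ g, ψ (φ g) = g) (g h : G) : wordDist S' (φ g) (φ h) = wordDist S g h := by
  rw [wordDist, wordDist, ← map_inv, ← map_mul, Nat.cast_inj]
  refine (wordLength_map_le hS hS' φ hφ _).antisymm ?_
  have := wordLength_map_le hS' hS ψ hψ (φ (g⁻¹ * h))
  rwa [hψφ] at this

universe u v

/-- The two factors of a binary free product, as a family indexed by `Bool`. -/
def BinaryFactor (G : Type u) (H : Type v) : Bool → Type (max u v)
  | true => ULift.{v} G
  | false => ULift.{u} H

variable {G : Type u} {H : Type v} [Group G] [Group H] {S : Set G} {T : Set H}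

instance BinaryFactor.group : ∀ i, Group (BinaryFactor G H i)
  | true => inferInstanceAs (Group (ULift.{v} G))
  | false => inferInstanceAs (Group (ULift.{u} H))

/-- The first group as a factor. -/
def BinaryFactor.fst : G ≃* BinaryFactor G H true := MulEquiv.ulift.symm

/-- The second group as a factor. -/
def BinaryFactor.snd : H ≃* BinaryFactor G H false := MulEquiv.ulift.symm

/-- The generating sets of the two factors. -/
def binaryGens (S : Set G) (T : Set H) : ∀ i, Set (BinaryFactor G H i)
  | true => BinaryFactor.fst '' S
  | false => BinaryFactor.snd '' T

lemma closure_image_mulEquiv {G G' : Type*} [Group G] [Group G'] {S : Set G}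
    (hS : Subgroup.closure S = ⊤) (e : G ≃* G') : Subgroup.closure (e '' S) = ⊤ := by
  have h := e.toMonoidHom.map_closure S
  rw [hS, ← MonoidHom.range_eq_map, MonoidHom.range_eq_top.2 e.surjective] at h
  exact h.symm

lemma ANdimLe.image_mulEquiv {G G' : Type*} [Group G] [Group G'] {S : Set G} {n : ℕ}
    (hS : Subgroup.closure S = ⊤) (e : G ≃* G') (h : ANdimLe (wordDist S) n) :
    ANdimLe (wordDist (e '' S)) n := by
  have hS' := closure_image_mulEquiv hS e
  refine h.of_isometry (wordDist_comm hS) (wordDist_comm hS') e.symm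
    (wordDist_map hS' hS e.symm.toMonoidHom e.toMonoidHom ?_ ?_ fun g => e.apply_symm_apply g)
  · rintro _ ⟨s, hs, rfl⟩
    exact Or.inl (by simpa using hs)
  · exact fun s hs => Or.inl ⟨s, hs, rfl⟩

lemma closure_binaryGens (hS : Subgroup.closure S = ⊤) (hT : Subgroup.closure T = ⊤) :
    ∀ i, Subgroup.closure (binaryGens S T i) = ⊤
  | true => closure_image_mulEquiv hS BinaryFactor.fst
  | false => closure_image_mulEquiv hT BinaryFactor.snd

lemma closure_image_inl_union_image_inr (hS : Subgroup.closure S = ⊤)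
    (hT : Subgroup.closure T = ⊤) :
    Subgroup.closure ((⇑(Coprod.inl : G →* Coprod G H) '' S) ∪
      (⇑(Coprod.inr : H →* Coprod G H) '' T)) = ⊤ := by
  rw [Subgroup.closure_union, ← MonoidHom.map_closure, ← MonoidHom.map_closure, hS, hT,
    ← MonoidHom.range_eq_map, ← MonoidHom.range_eq_map, Coprod.range_inl_sup_range_inr]

/-- The binary free product, seen inside the free product of the family of its factors. -/
def coprodToCoprodI : Coprod G H →* CoprodI (BinaryFactor G H) :=
  Coprod.lift ((CoprodI.of (i := true)).comp BinaryFactor.fst.toMonoidHom)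
    ((CoprodI.of (i := false)).comp BinaryFactor.snd.toMonoidHom)

/-- The inverse of `coprodToCoprodI`. -/
def coprodIToCoprod : CoprodI (BinaryFactor G H) →* Coprod G H :=
  CoprodI.lift fun
    | true => Coprod.inl.comp BinaryFactor.fst.symm.toMonoidHom
    | false => Coprod.inr.comp BinaryFactor.snd.symm.toMonoidHom

lemma coprodToCoprodI_inl (g : G) :
    coprodToCoprodI (Coprod.inl g : Coprod G H) = CoprodI.of (BinaryFactor.fst g) := by
  simp [coprodToCoprodI]

lemma coprodToCoprodI_inr (h : H) :
    coprodToCoprodI (Coprod.inr h : Coprod G H) = CoprodI.of (BinaryFactor.snd h) := by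
  simp [coprodToCoprodI]

lemma coprodIToCoprod_of_fst (g : G) :
    coprodIToCoprod (CoprodI.of (BinaryFactor.fst (H := H) g)) = Coprod.inl g := by
  simp [coprodIToCoprod]

lemma coprodIToCoprod_of_snd (h : H) :
    coprodIToCoprod (CoprodI.of (BinaryFactor.snd (G := G) h)) = Coprod.inr h := by
  simp [coprodIToCoprod]

lemma coprodIToCoprod_coprodToCoprodI (x : Coprod G H) :
    coprodIToCoprod (coprodToCoprodI x) = x := by
  have : (coprodIToCoprod.comp coprodToCoprodI : Coprod G H →* Coprod G H) = MonoidHom.id _ := by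
    refine Coprod.hom_ext ?_ ?_
    · ext g
      simp [coprodToCoprodI_inl, coprodIToCoprod_of_fst]
    · ext h
      simp [coprodToCoprodI_inr, coprodIToCoprod_of_snd]
  exact DFunLike.congr_fun this x

lemma ANdimLe.coprod {n : ℕ} (hS : Subgroup.closure S = ⊤) (hT : Subgroup.closure T = ⊤)
    (hn : n ≠ 0) (h₁ : ANdimLe (wordDist S) n) (h₂ : ANdimLe (wordDist T) n) :
    ANdimLe (wordDist ((⇑(Coprod.inl : G →* Coprod G H) '' S) ∪
      (⇑(Coprod.inr : H →* Coprod G H) '' T))) n := by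
  have hST := closure_binaryGens hS hT
  have hfactor : ∀ i, ANdimLe (wordDist (binaryGens S T i)) n
    | true => h₁.image_mulEquiv hS BinaryFactor.fst
    | false => h₂.image_mulEquiv hT BinaryFactor.snd
  have hgens := closure_image_inl_union_image_inr hS hT
  have hgens' := closure_coprodGens hST
  refine (ANdimLe.coprodI hST hn hfactor).of_isometry (wordDist_comm hgens')
    (wordDist_comm hgens) coprodToCoprodI (wordDist_map hgens hgens' coprodToCoprodI
      coprodIToCoprod ?_ ?_ coprodIToCoprod_coprodToCoprodI)
  · rintro _ (⟨s, hs, rfl⟩ | ⟨s, hs, rfl⟩)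
    · exact Or.inl (Set.mem_iUnion.2 ⟨true, _, ⟨s, hs, rfl⟩, (coprodToCoprodI_inl s).symm⟩)
    · exact Or.inl (Set.mem_iUnion.2 ⟨false, _, ⟨s, hs, rfl⟩, (coprodToCoprodI_inr s).symm⟩)
  · intro x hx
    obtain ⟨i, _, hy, rfl⟩ := Set.mem_iUnion.1 hx
    cases i with
    | true =>
      obtain ⟨s, hs, rfl⟩ := hy
      exact Or.inl (Or.inl ⟨s, hs, (coprodIToCoprod_of_fst s).symm⟩)
    | false =>
      obtain ⟨s, hs, rfl⟩ := hy
      exact Or.inl (Or.inr ⟨s, hs, (coprodIToCoprod_of_snd s).symm⟩)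

lemma ANdimLe.of_coprod {n : ℕ} (hS : Subgroup.closure S = ⊤) (hT : Subgroup.closure T = ⊤)
    (h : ANdimLe (wordDist ((⇑(Coprod.inl : G →* Coprod G H) '' S) ∪
      (⇑(Coprod.inr : H →* Coprod G H) '' T))) n) :
    ANdimLe (wordDist S) n ∧ ANdimLe (wordDist T) n := by
  have hgens := closure_image_inl_union_image_inr hS hT
  constructor
  · refine h.of_isometry (wordDist_comm hgens) (wordDist_comm hS) Coprod.inl
      (wordDist_map hS hgens Coprod.inl Coprod.fst (fun s hs => Or.inl (Or.inl ⟨s, hs, rfl⟩))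
        ?_ Coprod.fst_apply_inl)
    rintro _ (⟨s, hs, rfl⟩ | ⟨s, hs, rfl⟩) <;> simp [hs]
  · refine h.of_isometry (wordDist_comm hgens) (wordDist_comm hT) Coprod.inr
      (wordDist_map hT hgens Coprod.inr Coprod.snd (fun s hs => Or.inl (Or.inr ⟨s, hs, rfl⟩))
        ?_ Coprod.snd_apply_inr)
    rintro _ (⟨s, hs, rfl⟩ | ⟨s, hs, rfl⟩) <;> simp [hs]

end ANdimCoprod

/-- **Corollary.** For finitely generated infinite groups `G` and `H`, the asymptotic
Assouad–Nagata dimension of the free product `G ∗ H` (with the word metric coming from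
the union of the generating sets of `G` and `H`) equals
`max (asdim_AN G, asdim_AN H)`. -/
theorem asdimAN_freeProduct (G H : Type*) [Group G] [Group H]
    [Infinite G] [Infinite H]
    (S : Set G) (T : Set H) (hSfin : S.Finite) (hTfin : T.Finite)
    (hSgen : Subgroup.closure S = ⊤) (hTgen : Subgroup.closure T = ⊤) :
    asdimAN (wordDist
        ((⇑(Monoid.Coprod.inl : G →* Monoid.Coprod G H) '' S) ∪
          (⇑(Monoid.Coprod.inr : H →* Monoid.Coprod G H) '' T))) =
      max (asdimAN (wordDist S)) (asdimAN (wordDist T)) := by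
  have hgens := closure_image_inl_union_image_inr hSgen hTgen
  refine eq_of_forall_ge_iff fun N => ?_
  induction N with
  | top => simp
  | coe n =>
    rw [max_le_iff, asdimAN_le_iff (wordDist_comm hgens), asdimAN_le_iff (wordDist_comm hSgen),
      asdimAN_le_iff (wordDist_comm hTgen)]
    refine ⟨ANdimLe.of_coprod hSgen hTgen, fun h => h.1.coprod hSgen hTgen ?_ h.2⟩
    rintro rfl
    exact not_aNdimLe_zero hSfin hSgen h.1
end
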